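/- If q ∈ ℂ is nonzero and not a root of unity, then for every n ≥ 2 the Hecke–Clifford algebra G_n(q) is a semisimple ring, and its even subalgebra G_n[0] is a semisimple ring. -/

import Mathlib

noncomputable section

/-- Generator index type for the Hecke–Clifford algebra `G_n(q)`:
`Sum.inl i` is the braid-type generator `t_{i+1}` (the paper's 1-indexed `t_1, …, t_{n-1}`),
`Sum.inr j` is the Clifford generator `v_{j+1}` (the paper's 1-indexed `v_1, …, v_n`). -/
abbrev HCgen (n : ℕ) : Type := Fin (n - 1) ⊕ Fin n

/-- The generator `t_i` in the free algebra (0-indexed). -/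
def tF (n : ℕ) (i : Fin (n - 1)) : FreeAlgebra ℂ (HCgen n) :=
  FreeAlgebra.ι ℂ (Sum.inl i)

/-- The generator `v_j` in the free algebra (0-indexed). -/
def vF (n : ℕ) (j : Fin n) : FreeAlgebra ℂ (HCgen n) :=
  FreeAlgebra.ι ℂ (Sum.inr j)

/-- The defining relations of the Hecke–Clifford algebra `G_n(q)`. -/
inductive HCrel (q : ℂ) (n : ℕ) :
    FreeAlgebra ℂ (HCgen n) → FreeAlgebra ℂ (HCgen n) → Prop
  | braid (i j : Fin (n - 1)) (h : (j : ℕ) = (i : ℕ) + 1) :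
      HCrel q n (tF n i * tF n j * tF n i) (tF n j * tF n i * tF n j)
  | tcomm (i j : Fin (n - 1)) (h : (i : ℕ) + 2 ≤ (j : ℕ) ∨ (j : ℕ) + 2 ≤ (i : ℕ)) :
      HCrel q n (tF n i * tF n j) (tF n j * tF n i)
  | quad (i : Fin (n - 1)) :
      HCrel q n (tF n i * tF n i) (1 + (q - q⁻¹) • tF n i)
  | vsq (j : Fin n) :
      HCrel q n (vF n j * vF n j) 1
  | vanti (j k : Fin n) (h : j ≠ k) :
      HCrel q n (vF n j * vF n k) (-(vF n k * vF n j))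
  | tv₁ (i : Fin (n - 1)) (j j' : Fin n) (hj : (j : ℕ) = (i : ℕ))
      (hj' : (j' : ℕ) = (i : ℕ) + 1) :
      HCrel q n (tF n i * vF n j) (vF n j' * tF n i)
  | tv₂ (i : Fin (n - 1)) (j j' : Fin n) (hj : (j : ℕ) = (i : ℕ))
      (hj' : (j' : ℕ) = (i : ℕ) + 1) :
      HCrel q n (tF n i * vF n j') (vF n j * tF n i - (q - q⁻¹) • (vF n j - vF n j'))
  | tvcomm (i : Fin (n - 1)) (l : Fin n) (h : (l : ℕ) ≠ (i : ℕ) ∧ (l : ℕ) ≠ (i : ℕ) + 1) :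
      HCrel q n (tF n i * vF n l) (vF n l * tF n i)

/-- The Hecke–Clifford algebra `G_n(q)`. -/
abbrev HeckeClifford (q : ℂ) (n : ℕ) := RingQuot (HCrel q n)

/-- The generator `t_i` of `G_n(q)` (0-indexed: `i = 0, …, n-2`). -/
def HCt (q : ℂ) (n : ℕ) (i : Fin (n - 1)) : HeckeClifford q n :=
  RingQuot.mkAlgHom ℂ (HCrel q n) (tF n i)

/-- The generator `v_j` of `G_n(q)` (0-indexed: `j = 0, …, n-1`). -/
def HCv (q : ℂ) (n : ℕ) (j : Fin n) : HeckeClifford q n :=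
  RingQuot.mkAlgHom ℂ (HCrel q n) (vF n j)

/-- The element `e_i := v_i v_{i+1}` of `G_n(q)` (0-indexed: `i = 0, …, n-2`). -/
def HCe (q : ℂ) (n : ℕ) (i : Fin (n - 1)) : HeckeClifford q n :=
  HCv q n ⟨(i : ℕ), by have := i.2; omega⟩ * HCv q n ⟨(i : ℕ) + 1, by have := i.2; omega⟩

/-- The even subalgebra `G_n[0]` of `G_n(q)`, generated by the `t_i` and the `e_j`. -/
def HCeven (q : ℂ) (n : ℕ) : Subalgebra ℂ (HeckeClifford q n) :=
  Algebra.adjoin ℂ (Set.range (HCt q n) ∪ Set.range (HCe q n))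

end

set_option linter.unusedSectionVars false
set_option linter.unusedSimpArgs false

section TwoVertex
variable {R : Type*} [Ring R] [Algebra ℂ R] {z : ℂ} {T v w : R}

/-- The defining relations of the rank two Hecke–Clifford algebra. -/
structure IsHCPair (z : ℂ) (T v w : R) : Prop where
  quad : T * T = 1 + z • T
  vv : v * v = 1
  ww : w * w = 1
  wv : w * v = -(v * w)
  Tv : T * v = w * T
  Tw : T * w = v * T - z • (v - w)

namespace IsHCPair

theorem assoc_rules (h : IsHCPair z T v w) (x : R) :
    T * (T * x) = x + z • (T * x) ∧ v * (v * x) = x ∧ w * (w * x) = x ∧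
    w * (v * x) = -(v * (w * x)) ∧ T * (v * x) = w * (T * x) ∧
    T * (w * x) = v * (T * x) - z • (v * x - w * x) := by
  refine ⟨?_, ?_, ?_, ?_, ?_, ?_⟩
  · rw [← mul_assoc, h.quad, add_mul, one_mul, smul_mul_assoc]
  · rw [← mul_assoc, h.vv, one_mul]
  · rw [← mul_assoc, h.ww, one_mul]
  · rw [← mul_assoc, h.wv, neg_mul, mul_assoc]
  · rw [← mul_assoc, h.Tv, mul_assoc]
  · rw [← mul_assoc, h.Tw, sub_mul, smul_mul_assoc, sub_mul, mul_assoc]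

/-- `S = T + z v w` commutes past the Clifford generators in the order opposite to `T`. -/
theorem S_mul_w (h : IsHCPair z T v w) : (T + z • (v * w)) * w = v * (T + z • (v * w)) := by
  simp only [mul_add, add_mul, mul_assoc, smul_mul_assoc, mul_smul_comm, h.ww, h.Tw,
    (h.assoc_rules _).2.1]
  simp only [mul_one]
  module

theorem w_mul_S (h : IsHCPair z T v w) : w * (T + z • (v * w)) = (T - z • 1) * v := by
  have a := fun x => (h.assoc_rules x).2.2.2.1
  simp only [mul_add, sub_mul, mul_assoc, smul_mul_assoc, mul_smul_comm, h.ww, h.Tv, a, one_mul]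
  simp only [mul_one]
  module

theorem T_inv (h : IsHCPair z T v w) : T * (T - z • 1) = 1 := by
  simp only [mul_sub, h.quad, mul_smul_comm, mul_one]; module

theorem inv_T (h : IsHCPair z T v w) : (T - z • 1) * T = 1 := by
  simp only [sub_mul, h.quad, smul_mul_assoc, one_mul]; module

theorem S_sq (h : IsHCPair z T v w) :
    (T + z • (v * w)) * (T + z • (v * w)) = 1 + z • (T + z • (v * w)) := by
  have a := fun x => h.assoc_rules x
  simp only [mul_add, add_mul, mul_assoc, smul_mul_assoc, mul_smul_comm, h.ww, h.wv, h.Tv, h.Tw,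
    h.quad, h.vv, (a _).1, (a _).2.1, (a _).2.2.1, (a _).2.2.2.1, (a _).2.2.2.2.1,
    (a _).2.2.2.2.2, mul_sub, sub_mul, mul_neg, neg_mul, mul_one, one_mul, neg_neg]
  module

theorem S_mul_T (h : IsHCPair z T v w) :
    (T + z • (v * w)) * T = 1 + z • T + z • (v * w * T) := by
  rw [add_mul, h.quad, smul_mul_assoc]

theorem S_inv (h : IsHCPair z T v w) :
    (T + z • (v * w)) * (T + z • (v * w) - z • 1) = 1 := by
  rw [mul_sub, h.S_sq, mul_smul_comm, mul_one]; module

theorem inv_S (h : IsHCPair z T v w) :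
    (T + z • (v * w) - z • 1) * (T + z • (v * w)) = 1 := by
  rw [sub_mul, h.S_sq, smul_mul_assoc, one_mul]; module

theorem fourTerm_commute (h : IsHCPair z T v w) {g : R} (hg : v * g = g * v) :
    T * (g + w * g * w + T * g * (T + z • (v * w)) + v * (T * g * (T + z • (v * w))) * v) =
    (g + w * g * w + T * g * (T + z • (v * w)) + v * (T * g * (T + z • (v * w))) * v) * T := by
  have a := fun x => h.assoc_rules x
  have hg' : ∀ x, g * (v * x) = v * (g * x) := fun x => by
    rw [← mul_assoc, ← hg, mul_assoc]
  simp only [mul_add, add_mul, mul_assoc, smul_mul_assoc, mul_smul_comm, h.ww, h.wv, h.Tv, h.Tw,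
    h.quad, h.vv, (a _).1, (a _).2.1, (a _).2.2.1, (a _).2.2.2.1, (a _).2.2.2.2.1,
    (a _).2.2.2.2.2, mul_sub, sub_mul, mul_neg, neg_mul, mul_one, one_mul, neg_neg, smul_add,
    smul_sub, ← hg, hg', smul_neg]
  module

end IsHCPair
end TwoVertex

section Sequences
variable {R : Type*} [Ring R] [Algebra ℂ R] {z : ℂ} {N : ℕ} {t v : ℕ → R}

/-- `t 0, …, t (N - 2)` and `v 0, …, v (N - 1)` satisfy the Hecke–Clifford relations with
parameter `z = q - q⁻¹`. -/
structure IsHeckeClifford (z : ℂ) (N : ℕ) (t v : ℕ → R) : Prop where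
  braid : ∀ i, i + 2 < N → t i * t (i + 1) * t i = t (i + 1) * t i * t (i + 1)
  tcomm : ∀ i j, i + 2 ≤ j → j + 1 < N → t i * t j = t j * t i
  quad : ∀ i, i + 1 < N → t i * t i = 1 + z • t i
  vsq : ∀ j < N, v j * v j = 1
  vanti : ∀ j k, j < N → k < N → j ≠ k → v j * v k = -(v k * v j)
  tv₁ : ∀ i, i + 1 < N → t i * v i = v (i + 1) * t i
  tv₂ : ∀ i, i + 1 < N → t i * v (i + 1) = v i * t i - z • (v i - v (i + 1))
  tvcomm : ∀ i l, i + 1 < N → l < N → l ≠ i → l ≠ i + 1 → t i * v l = v l * t i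

/-- The twisted generator `t i + z v_i v_{i+1}`. -/
def hcS (z : ℂ) (t v : ℕ → R) (i : ℕ) : R := t i + z • (v i * v (i + 1))

/-- The Jucys–Murphy elements. -/
def hcJ (z : ℂ) (t v : ℕ → R) : ℕ → R
  | 0 => 1
  | k + 1 => hcS z t v k * hcJ z t v k * t k

/-- The inverses of the Jucys–Murphy elements. -/
def hcJinv (z : ℂ) (t v : ℕ → R) : ℕ → R
  | 0 => 1
  | k + 1 => (t k - z • 1) * hcJinv z t v k * (hcS z t v k - z • 1)

/-- The relative Casimir operator from the centralizer of the first `m` strands to the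
centralizer of the first `m + 1` strands. -/
def hcCas (z : ℂ) (t v : ℕ → R) : ℕ → R →ₗ[ℂ] R
  | 0 => LinearMap.id + LinearMap.mulLeft ℂ (v 0) ∘ₗ LinearMap.mulRight ℂ (v 0)
  | m + 1 => LinearMap.id + LinearMap.mulLeft ℂ (v (m + 1)) ∘ₗ LinearMap.mulRight ℂ (v (m + 1)) +
      hcCas z t v m ∘ₗ LinearMap.mulLeft ℂ (t m) ∘ₗ LinearMap.mulRight ℂ (hcS z t v m)

theorem hcCas_zero_apply (g : R) : hcCas z t v 0 g = g + v 0 * g * v 0 := by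
  simp [hcCas, mul_assoc]

theorem hcCas_succ_apply (m : ℕ) (g : R) : hcCas z t v (m + 1) g =
    g + v (m + 1) * g * v (m + 1) + hcCas z t v m (t m * g * hcS z t v m) := by
  simp [hcCas, mul_assoc]

/-- `g` commutes with the generators supported on the first `m` strands. -/
structure HCCentralizes (t v : ℕ → R) (m : ℕ) (g : R) : Prop where
  comm_v : ∀ j < m, Commute (v j) g
  comm_t : ∀ i, i + 1 < m → Commute (t i) g

namespace HCCentralizes
variable {m : ℕ} {g g' : R}

theorem mono (h : HCCentralizes t v m g) {k : ℕ} (hk : k ≤ m) : HCCentralizes t v k g :=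
  ⟨fun j hj => h.comm_v j (by omega), fun i hi => h.comm_t i (by omega)⟩

theorem mul (h : HCCentralizes t v m g) (h' : HCCentralizes t v m g') :
    HCCentralizes t v m (g * g') :=
  ⟨fun j hj => (h.comm_v j hj).mul_right (h'.comm_v j hj),
    fun i hi => (h.comm_t i hi).mul_right (h'.comm_t i hi)⟩

theorem add (h : HCCentralizes t v m g) (h' : HCCentralizes t v m g') :
    HCCentralizes t v m (g + g') :=
  ⟨fun j hj => (h.comm_v j hj).add_right (h'.comm_v j hj),
    fun i hi => (h.comm_t i hi).add_right (h'.comm_t i hi)⟩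

theorem smul (h : HCCentralizes t v m g) (c : ℂ) : HCCentralizes t v m (c • g) :=
  ⟨fun j hj => (h.comm_v j hj).smul_right c, fun i hi => (h.comm_t i hi).smul_right c⟩

theorem one : HCCentralizes t v m (1 : R) :=
  ⟨fun _ _ => Commute.one_right _, fun _ _ => Commute.one_right _⟩

theorem sub (h : HCCentralizes t v m g) (h' : HCCentralizes t v m g') :
    HCCentralizes t v m (g - g') :=
  ⟨fun j hj => (h.comm_v j hj).sub_right (h'.comm_v j hj),
    fun i hi => (h.comm_t i hi).sub_right (h'.comm_t i hi)⟩

theorem of_inv {a b : R} (h : HCCentralizes t v m a) (hab : a * b = 1) (hba : b * a = 1) :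
    HCCentralizes t v m b :=
  ⟨fun j hj => (Commute.units_inv_right (u := ⟨a, b, hab, hba⟩) (h.comm_v j hj)),
    fun i hi => (Commute.units_inv_right (u := ⟨a, b, hab, hba⟩) (h.comm_t i hi))⟩

end HCCentralizes

namespace IsHeckeClifford
variable (H : IsHeckeClifford z N t v)
include H

theorem pair {i : ℕ} (hi : i + 1 < N) : IsHCPair z (t i) (v i) (v (i + 1)) :=
  ⟨H.quad i hi, H.vsq i (by omega), H.vsq _ hi, H.vanti _ _ hi (by omega) (by omega),
    H.tv₁ i hi, H.tv₂ i hi⟩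

theorem commute_t_t {i j : ℕ} (hij : i + 2 ≤ j ∨ j + 2 ≤ i) (hi : i + 1 < N) (hj : j + 1 < N) :
    Commute (t i) (t j) := by
  rcases hij with h | h
  · exact H.tcomm i j h hj
  · exact (H.tcomm j i h hi).symm

theorem commute_v_t {i l : ℕ} (hi : i + 1 < N) (hl : l < N) (h₁ : l ≠ i) (h₂ : l ≠ i + 1) :
    Commute (v l) (t i) := (H.tvcomm i l hi hl h₁ h₂).symm

theorem commute_v_vv {j k l : ℕ} (hj : j < N) (hk : k < N) (hl : l < N) (hjk : j ≠ k)
    (hjl : j ≠ l) : Commute (v j) (v k * v l) := by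
  rw [Commute, SemiconjBy, ← mul_assoc, H.vanti j k hj hk hjk, neg_mul, mul_assoc,
    H.vanti j l hj hl hjl, mul_neg, neg_neg, mul_assoc]

theorem commute_v_S {i l : ℕ} (hi : i + 1 < N) (hl : l < N) (h₁ : l ≠ i) (h₂ : l ≠ i + 1) :
    Commute (v l) (hcS z t v i) :=
  (H.commute_v_t hi hl h₁ h₂).add_right
    ((H.commute_v_vv hl (by omega) hi h₁ h₂).smul_right z)

theorem commute_t_S {i j : ℕ} (hij : i + 2 ≤ j ∨ j + 2 ≤ i) (hi : i + 1 < N) (hj : j + 1 < N) :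
    Commute (t i) (hcS z t v j) :=
  (H.commute_t_t hij hi hj).add_right
    ((((H.commute_v_t hi (l := j) (by omega) (by omega) (by omega)).symm).mul_right
      ((H.commute_v_t hi (l := j + 1) (by omega) (by omega) (by omega)).symm)).smul_right z)

theorem centralizes_t {m : ℕ} (hm : m + 1 < N) : HCCentralizes t v m (t m) :=
  ⟨fun j hj => H.commute_v_t hm (by omega) (by omega) (by omega),
    fun i hi => H.commute_t_t (by omega) (by omega) hm⟩

theorem centralizes_S {m : ℕ} (hm : m + 1 < N) : HCCentralizes t v m (hcS z t v m) :=
  ⟨fun j hj => H.commute_v_S hm (by omega) (by omega) (by omega),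
    fun i hi => H.commute_t_S (by omega) (by omega) hm⟩

/-- Conjugation by `v k` preserves the centralizer of earlier strands. -/
theorem centralizes_conj {m k : ℕ} {g : R} (hg : HCCentralizes t v m g) (hmk : m ≤ k)
    (hk : k < N) : HCCentralizes t v m (v k * g * v k) := by
  constructor
  · intro j hj
    have h1 := H.vanti j k (by omega) hk (by omega)
    have h2 := (hg.comm_v j hj).eq
    rw [Commute, SemiconjBy]
    calc v j * (v k * g * v k) = v j * v k * g * v k := by simp only [mul_assoc]
      _ = -(v k * (v j * g) * v k) := by rw [h1]; simp only [neg_mul, mul_assoc]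
      _ = v k * g * (-(v j * v k)) := by rw [h2]; simp only [mul_neg, mul_assoc]
      _ = v k * g * v k * v j := by rw [h1]; simp only [neg_neg, mul_assoc]
  · intro i hi
    have h1 := (H.commute_v_t (i := i) (l := k) (by omega) hk (by omega) (by omega)).symm
    exact (h1.mul_right (hg.comm_t i hi)).mul_right h1

theorem braid_S_last {i : ℕ} (hi : i + 2 < N) :
    t i * t (i + 1) * hcS z t v i = hcS z t v (i + 1) * t i * t (i + 1) := by
  have e : t i * t (i + 1) * (v i * v (i + 1)) = v (i + 1) * v (i + 2) * (t i * t (i + 1)) := by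
    have a1 : t (i + 1) * v i = v i * t (i + 1) := H.tvcomm _ _ hi (by omega) (by omega) (by omega)
    have a2 : t (i + 1) * v (i + 1) = v (i + 2) * t (i + 1) := H.tv₁ _ hi
    have a3 : t i * v i = v (i + 1) * t i := H.tv₁ _ (by omega)
    have a4 : t i * v (i + 2) = v (i + 2) * t i :=
      H.tvcomm _ _ (by omega) hi (by omega) (by omega)
    calc _ = t i * (t (i + 1) * v i) * v (i + 1) := by simp only [mul_assoc]
      _ = (t i * v i) * (t (i + 1) * v (i + 1)) := by rw [a1]; simp only [mul_assoc]
      _ = v (i + 1) * (t i * v (i + 2)) * t (i + 1) := by rw [a2, a3]; simp only [mul_assoc]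
      _ = _ := by rw [a4]; simp only [mul_assoc]
  rw [hcS, hcS, mul_add, mul_smul_comm, e, add_mul, add_mul, smul_mul_assoc, smul_mul_assoc,
    H.braid i hi]
  simp only [mul_assoc]

theorem braid_S_S {i : ℕ} (hi : i + 2 < N) :
    t i * hcS z t v (i + 1) * hcS z t v i = hcS z t v (i + 1) * hcS z t v i * t (i + 1) := by
  have h1 := H.pair (i := i) (by omega)
  have h2 := H.pair (i := i + 1) hi
  have a1 : t (i + 1) * v i = v i * t (i + 1) := H.tvcomm _ _ hi (by omega) (by omega) (by omega)
  have a4 : t i * v (i + 2) = v (i + 2) * t i :=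
    H.tvcomm _ _ (by omega) hi (by omega) (by omega)
  have a5 : v (i + 2) * v i = -(v i * v (i + 2)) := H.vanti _ _ hi (by omega) (by omega)
  have b := H.braid i hi
  have a1' (x) : t (i + 1) * (v i * x) = v i * (t (i + 1) * x) := by
    rw [← mul_assoc, a1, mul_assoc]
  have a4' (x) : t i * (v (i + 2) * x) = v (i + 2) * (t i * x) := by
    rw [← mul_assoc, a4, mul_assoc]
  have a5' (x) : v (i + 2) * (v i * x) = -(v i * (v (i + 2) * x)) := by
    rw [← mul_assoc, a5, neg_mul, mul_assoc]
  have b' : t i * (t (i + 1) * t i) = t (i + 1) * (t i * t (i + 1)) := by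
    simpa only [mul_assoc] using b
  have r1 := fun x => h1.assoc_rules x
  have r2 := fun x => h2.assoc_rules x
  simp only [add_assoc, Nat.reduceAdd] at r2 h2 ⊢
  have c1 := h1.Tv; have c2 := h1.Tw; have c3 := h1.quad; have c4 := h1.wv
  have d1 := h2.Tv; have d2 := h2.Tw; have d3 := h2.quad; have d4 := h2.wv
  have d5 := h2.ww; have d6 := h2.vv; have c6 := h1.vv
  simp only [hcS, add_assoc, Nat.reduceAdd] at *
  simp only [mul_add, add_mul, mul_assoc, smul_mul_assoc, mul_smul_comm, mul_sub, sub_mul, mul_neg,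
    neg_mul, mul_one, one_mul, neg_neg, smul_add, smul_sub, smul_neg, a1, a4, a5, a1', a4', a5',
    b', c1, c2, c3, c4, d1, d2, d3, d4, d5, d6, c6, (r1 _).1, (r1 _).2.1, (r1 _).2.2.1,
    (r1 _).2.2.2.1, (r1 _).2.2.2.2.1, (r1 _).2.2.2.2.2, (r2 _).1, (r2 _).2.1, (r2 _).2.2.1,
    (r2 _).2.2.2.1, (r2 _).2.2.2.2.1, (r2 _).2.2.2.2.2]
  module

end IsHeckeClifford
end Sequences

theorem mul_mul_mul_inv_cancel {M : Type*} [Monoid M] {a b c a' b' c' : M}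
    (ha : a * a' = 1) (hb : b * b' = 1)
    (hc : c * c' = 1) : a * b * c * (c' * b' * a') = 1 := by
  calc a * b * c * (c' * b' * a') = a * (b * (c * c') * b') * a' := by simp only [mul_assoc]
    _ = 1 := by rw [hc, mul_one, hb, mul_one, ha]

section JucysMurphy
variable {R : Type*} [Ring R] [Algebra ℂ R] {z : ℂ} {N : ℕ} {t v : ℕ → R}

namespace HCCentralizes
variable {g : R}

theorem commute_S {i : ℕ} (hg : HCCentralizes t v (i + 2) g) : Commute (hcS z t v i) g :=
  (hg.comm_t i (by omega)).add_left
    (((hg.comm_v i (by omega)).mul_left (hg.comm_v (i + 1) (by omega))).smul_left z)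

theorem commute_J {i : ℕ} (hg : HCCentralizes t v (i + 1) g) : Commute (hcJ z t v i) g := by
  induction i with
  | zero => exact Commute.one_left _
  | succ i ih =>
    exact (hg.commute_S.mul_left (ih (hg.mono (by omega)))).mul_left (hg.comm_t i (by omega))

end HCCentralizes

namespace IsHeckeClifford
variable (H : IsHeckeClifford z N t v)
include H

theorem J_mul_Jinv {k : ℕ} (hk : k < N) : hcJ z t v k * hcJinv z t v k = 1 := by
  induction k with
  | zero => exact one_mul _
  | succ k ih => exact mul_mul_mul_inv_cancel (H.pair hk).S_inv (ih (by omega)) (H.pair hk).T_inv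

theorem Jinv_mul_J {k : ℕ} (hk : k < N) : hcJinv z t v k * hcJ z t v k = 1 := by
  induction k with
  | zero => exact one_mul _
  | succ k ih => exact mul_mul_mul_inv_cancel (H.pair hk).inv_T (ih (by omega)) (H.pair hk).inv_S

theorem commute_v_J_of_lt {k j : ℕ} (hkj : k < j) (hj : j < N) :
    Commute (v j) (hcJ z t v k) := by
  induction k with
  | zero => exact Commute.one_right _
  | succ k ih =>
    exact ((H.commute_v_S (by omega) hj (by omega) (by omega)).mul_right (ih (by omega))).mul_right
      (H.commute_v_t (by omega) hj (by omega) (by omega))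

theorem commute_t_J_of_lt {k i : ℕ} (hki : k < i) (hi : i + 1 < N) :
    Commute (t i) (hcJ z t v k) := by
  induction k with
  | zero => exact Commute.one_right _
  | succ k ih =>
    exact ((H.commute_t_S (by omega) hi (by omega)).mul_right (ih (by omega))).mul_right
      (H.commute_t_t (by omega) hi (by omega))

theorem centralizes_J {k : ℕ} (hk : k < N) : HCCentralizes t v k (hcJ z t v k) := by
  induction k with
  | zero => exact HCCentralizes.one
  | succ k ih =>
    have hlow : HCCentralizes t v k (hcJ z t v (k + 1)) :=
      ((H.centralizes_S hk).mul (ih (by omega))).mul (H.centralizes_t hk)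
    constructor
    · intro j hj
      rcases Nat.lt_succ_iff_lt_or_eq.mp hj with h | rfl
      · exact hlow.comm_v j h
      · have h1 : hcS z t v j * v (j + 1) = v j * hcS z t v j := (H.pair hk).S_mul_w
        have h2 := (H.commute_v_J_of_lt (Nat.lt_succ_self j) hk).eq
        rw [Nat.succ_eq_add_one] at h2
        rw [hcJ, Commute, SemiconjBy, ← mul_assoc, ← mul_assoc, ← h1, mul_assoc (hcS z t v j), h2,
          mul_assoc, mul_assoc, mul_assoc, mul_assoc, (H.pair hk).Tv]
    · intro i hi
      rcases Nat.lt_succ_iff_lt_or_eq.mp (show i + 1 < k + 1 from hi) with h | h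
      · exact hlow.comm_t i h
      · obtain rfl : k = i + 1 := by omega
        have h1 := H.braid_S_S (i := i) (by omega)
        have h2 := (H.commute_t_J_of_lt (Nat.lt_succ_self i) (by omega)).eq
        have h3 := H.braid i (by omega)
        rw [Nat.succ_eq_add_one] at h2
        rw [Commute, SemiconjBy, hcJ, hcJ]
        calc _ = t i * hcS z t v (i + 1) * hcS z t v i * hcJ z t v i * t i * t (i + 1) := by
              simp only [mul_assoc]
          _ = hcS z t v (i + 1) * hcS z t v i * (t (i + 1) * hcJ z t v i) * t i * t (i + 1) := by
              rw [h1]; simp only [mul_assoc]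
          _ = hcS z t v (i + 1) * hcS z t v i * hcJ z t v i * (t (i + 1) * t i * t (i + 1)) := by
              rw [h2]; simp only [mul_assoc]
          _ = _ := by rw [← h3]; simp only [mul_assoc]

theorem centralizes_Jinv {k : ℕ} (hk : k < N) : HCCentralizes t v k (hcJinv z t v k) :=
  (H.centralizes_J hk).of_inv (H.J_mul_Jinv hk) (H.Jinv_mul_J hk)

theorem commute_J_J {i j : ℕ} (hi : i < N) (hj : j < N) :
    Commute (hcJ z t v i) (hcJ z t v j) := by
  rcases lt_trichotomy i j with h | rfl | h
  · exact ((H.centralizes_J hj).mono h).commute_J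
  · rfl
  · exact ((H.centralizes_J hi).mono h).commute_J.symm

theorem commute_Jinv_J {i j : ℕ} (hi : i < N) (hj : j < N) :
    Commute (hcJinv z t v i) (hcJ z t v j) :=
  Commute.units_inv_left (u := ⟨_, _, H.J_mul_Jinv hi, H.Jinv_mul_J hi⟩) (H.commute_J_J hi hj)

theorem commute_Jinv_Jinv {i j : ℕ} (hi : i < N) (hj : j < N) :
    Commute (hcJinv z t v i) (hcJinv z t v j) :=
  Commute.units_inv_right (u := ⟨_, _, H.J_mul_Jinv hj, H.Jinv_mul_J hj⟩) (H.commute_Jinv_J hi hj)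

theorem v_mul_J {k : ℕ} (hk : k < N) : v k * hcJ z t v k = hcJinv z t v k * v k := by
  induction k with
  | zero => simp [hcJ, hcJinv]
  | succ k ih =>
    have h1 : v (k + 1) * hcS z t v k = (t k - z • 1) * v k := (H.pair hk).w_mul_S
    have h2 : (hcS z t v k - z • 1) * v (k + 1) = v k * t k := by
      rw [sub_mul, hcS, (H.pair hk).S_mul_w, mul_add, mul_smul_comm, ← mul_assoc, (H.pair hk).vv,
        one_mul, smul_mul_assoc, one_mul, add_sub_cancel_right]
    rw [hcJ, hcJinv, ← mul_assoc, ← mul_assoc, h1, mul_assoc _ (v k), ih (by omega), mul_assoc,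
      mul_assoc, mul_assoc, mul_assoc, h2]

theorem v_mul_Jinv {k : ℕ} (hk : k < N) : v k * hcJinv z t v k = hcJ z t v k * v k := by
  have h := H.v_mul_J hk
  have h' := H.vsq k hk
  calc _ = v k * (hcJinv z t v k * v k) * v k := by rw [mul_assoc, mul_assoc, h', mul_one]
    _ = v k * v k * hcJ z t v k * v k := by rw [← h]; simp only [mul_assoc]
    _ = _ := by rw [h', one_mul]

end IsHeckeClifford

/-- The symmetrized Jucys–Murphy elements. -/
def hcX (z : ℂ) (t v : ℕ → R) (k : ℕ) : R := hcJ z t v k + hcJinv z t v k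

namespace IsHeckeClifford
variable (H : IsHeckeClifford z N t v)
include H

theorem centralizes_X {k : ℕ} (hk : k < N) : HCCentralizes t v k (hcX z t v k) :=
  (H.centralizes_J hk).add (H.centralizes_Jinv hk)

theorem commute_v_X {k : ℕ} (hk : k < N) : Commute (v k) (hcX z t v k) := by
  rw [Commute, SemiconjBy, hcX, mul_add, add_mul, H.v_mul_J hk, H.v_mul_Jinv hk, add_comm]

theorem commute_X_X {i j : ℕ} (hi : i < N) (hj : j < N) :
    Commute (hcX z t v i) (hcX z t v j) :=
  ((H.commute_J_J hi hj).add_right (H.commute_Jinv_J hj hi).symm).add_left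
    ((H.commute_Jinv_J hi hj).add_right (H.commute_Jinv_Jinv hi hj))

theorem commute_J_X {i j : ℕ} (hi : i < N) (hj : j < N) :
    Commute (hcJ z t v i) (hcX z t v j) :=
  (H.commute_J_J hi hj).add_right (H.commute_Jinv_J hj hi).symm

theorem commute_Jinv_X {i j : ℕ} (hi : i < N) (hj : j < N) :
    Commute (hcJinv z t v i) (hcX z t v j) :=
  (H.commute_Jinv_J hi hj).add_right (H.commute_Jinv_Jinv hi hj)

end IsHeckeClifford
end JucysMurphy

section Casimir
variable {R : Type*} [Ring R] [Algebra ℂ R] {z : ℂ} {N : ℕ} {t v : ℕ → R}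

namespace HCCentralizes
variable {m : ℕ} {c : R}

theorem cas_mul_right (hc : HCCentralizes t v (m + 1) c) (g : R) :
    hcCas z t v m (g * c) = hcCas z t v m g * c := by
  induction m generalizing g with
  | zero =>
    have := (hc.comm_v 0 (by omega)).eq
    rw [hcCas_zero_apply, hcCas_zero_apply, add_mul]
    simp only [mul_assoc, this]
  | succ m ih =>
    have h1 := (hc.comm_v (m + 1) (by omega)).eq
    have h2 := (hc.commute_S (z := z)).eq
    rw [hcCas_succ_apply, hcCas_succ_apply, add_mul, add_mul, ← ih (hc.mono (by omega))]
    simp only [mul_assoc, h1, h2]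

theorem cas_mul_left (hc : HCCentralizes t v (m + 1) c) (g : R) :
    hcCas z t v m (c * g) = c * hcCas z t v m g := by
  induction m generalizing g with
  | zero =>
    have := (hc.comm_v 0 (by omega)).eq
    rw [hcCas_zero_apply, hcCas_zero_apply, mul_add]
    simp only [← mul_assoc, this]
  | succ m ih =>
    have h1 := (hc.comm_v (m + 1) (by omega)).eq
    have h2 := (hc.comm_t m (by omega)).eq
    rw [hcCas_succ_apply, hcCas_succ_apply, mul_add, mul_add, ← ih (hc.mono (by omega))]
    simp only [← mul_assoc, h1, h2]

end HCCentralizes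

namespace IsHeckeClifford
variable (H : IsHeckeClifford z N t v)
include H

theorem centralizes_TgS {m : ℕ} (hm : m + 1 < N) {g : R} (hg : HCCentralizes t v (m + 1) g) :
    HCCentralizes t v m (t m * g * hcS z t v m) :=
  ((H.centralizes_t hm).mul (hg.mono (by omega))).mul (H.centralizes_S hm)

theorem commute_t_TgS {m : ℕ} (hm : m + 2 < N) {g : R} (hg : HCCentralizes t v (m + 2) g) :
    Commute (t (m + 1)) (t m * (t (m + 1) * g * hcS z t v (m + 1)) * hcS z t v m) := by
  have h1 := H.braid m hm
  have h2 := H.braid_S_S hm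
  have h3 := (hg.comm_t m (by omega)).eq
  rw [Commute, SemiconjBy]
  calc _ = t (m + 1) * t m * t (m + 1) * g * hcS z t v (m + 1) * hcS z t v m := by
        simp only [mul_assoc]
    _ = t m * t (m + 1) * (t m * g) * hcS z t v (m + 1) * hcS z t v m := by
        rw [← h1]; simp only [mul_assoc]
    _ = t m * t (m + 1) * g * (t m * hcS z t v (m + 1) * hcS z t v m) := by
        rw [h3]; simp only [mul_assoc]
    _ = _ := by rw [h2]; simp only [mul_assoc]

theorem cas_conj {m k : ℕ} (hmk : m < k) (hk : k < N) (g : R) :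
    hcCas z t v m (v k * g * v k) = v k * hcCas z t v m g * v k := by
  induction m generalizing g with
  | zero =>
    have h := H.vanti 0 k (by omega) hk (by omega)
    have h' : v k * v 0 = -(v 0 * v k) := by rw [h, neg_neg]
    rw [hcCas_zero_apply, hcCas_zero_apply, mul_add, add_mul]
    congr 1
    calc v 0 * (v k * g * v k) * v 0 = v 0 * v k * g * (v k * v 0) := by simp only [mul_assoc]
      _ = -(v k * v 0) * g * -(v 0 * v k) := by rw [← h, ← h']
      _ = _ := by simp only [mul_neg, neg_mul, neg_neg, mul_assoc]
  | succ m ih =>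
    have h := H.vanti (m + 1) k (by omega) hk (by omega)
    have h' : v k * v (m + 1) = -(v (m + 1) * v k) := by rw [h, neg_neg]
    have h1 := (H.commute_v_t (i := m) (by omega) hk (by omega) (by omega)).eq
    have h2 := (H.commute_v_S (i := m) (by omega) hk (by omega) (by omega)).eq
    have h3 : t m * (v k * g * v k) * hcS z t v m = v k * (t m * g * hcS z t v m) * v k := by
      calc _ = t m * v k * g * (v k * hcS z t v m) := by simp only [mul_assoc]
        _ = _ := by rw [h2, ← h1]; simp only [mul_assoc]
    rw [hcCas_succ_apply, hcCas_succ_apply, mul_add, add_mul, mul_add, add_mul, h3,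
      ih (by omega)]
    congr 2
    calc _ = v (m + 1) * v k * g * (v k * v (m + 1)) := by simp only [mul_assoc]
      _ = -(v k * v (m + 1)) * g * -(v (m + 1) * v k) := by rw [← h, ← h']
      _ = _ := by simp only [mul_neg, neg_mul, neg_neg, mul_assoc]

theorem commute_v_TgS {m : ℕ} (hm : m + 1 < N) {g : R} (hg : Commute (v m) g) :
    v (m + 1) * (t m * g * hcS z t v m) * v (m + 1) = t m * g * hcS z t v m := by
  have h1 := (H.pair hm).S_mul_w
  have h2 := (H.pair hm).Tv
  have h3 := H.vsq m (by omega)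
  calc _ = v (m + 1) * t m * g * (hcS z t v m * v (m + 1)) := by simp only [mul_assoc]
    _ = t m * (v m * g * v m) * hcS z t v m := by rw [← h2, hcS, h1]; simp only [mul_assoc]
    _ = _ := by rw [hg.eq, mul_assoc g, h3, mul_one]

/-- The relative Casimir operator maps the centralizer of the first `m` strands into the
centralizer of the first `m + 1` strands. -/
theorem centralizes_cas {m : ℕ} (hm : m < N) {g : R} (hg : HCCentralizes t v m g) :
    HCCentralizes t v (m + 1) (hcCas z t v m g) := by
  induction m generalizing g with
  | zero =>
    refine ⟨fun j hj => ?_, fun i hi => by omega⟩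
    obtain rfl : j = 0 := by omega
    have h := H.vsq 0 hm
    rw [hcCas_zero_apply, Commute, SemiconjBy, mul_add, add_mul, mul_assoc (v 0) g, ← mul_assoc,
      h, one_mul, mul_assoc, mul_assoc, h, mul_one, add_comm]
  | succ m ih =>
    have hT := ih (by omega) (H.centralizes_TgS hm hg)
    rw [hcCas_succ_apply]
    constructor
    · intro j hj
      rcases Nat.lt_succ_iff_lt_or_eq.mp hj with h | rfl
      · exact ((hg.add (H.centralizes_conj hg le_rfl hm)).add hT).comm_v j h
      · refine Commute.add_right ?_ ?_
        · have h := H.vsq _ hm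
          rw [Commute, SemiconjBy, mul_add, add_mul, mul_assoc (v (m + 1)) g, ← mul_assoc, h,
            one_mul, mul_assoc, mul_assoc, h, mul_one, add_comm]
        · have h1 : v (m + 1) * hcCas z t v m (t m * g * hcS z t v m) * v (m + 1) =
              hcCas z t v m (t m * g * hcS z t v m) := by
            rw [← H.cas_conj (by omega) hm, H.commute_v_TgS hm (hg.comm_v m (by omega))]
          have h := H.vsq _ hm
          rw [Commute, SemiconjBy]
          nth_rewrite 2 [← h1]
          rw [mul_assoc _ (v (m + 1)), h, mul_one]
    · intro i hi
      rcases Nat.lt_succ_iff_lt_or_eq.mp (show i + 1 < m + 1 + 1 from hi) with h | h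
      · exact ((hg.add (H.centralizes_conj hg le_rfl hm)).add hT).comm_t i h
      · obtain rfl : i = m := by omega
        have h4 := (H.pair hm).fourTerm_commute (hg.comm_v i (by omega)).eq
        rcases i with _ | i
        · rw [hcCas_zero_apply, ← add_assoc]
          exact h4
        · rw [hcCas_succ_apply, ← add_assoc, ← add_assoc]
          refine Commute.add_right h4 ?_
          have h5 := (H.centralizes_t hm)
          rw [Commute, SemiconjBy, ← h5.cas_mul_left, ← h5.cas_mul_right,
            (H.commute_t_TgS hm hg).eq]

theorem smul_cas_t {m : ℕ} (hm : m + 1 < N) : z • hcCas z t v m (t m) = hcJ z t v (m + 1) - 1 := by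
  induction m with
  | zero =>
    have h := H.pair hm
    rw [hcCas_zero_apply, hcJ, hcJ, mul_one, hcS, h.S_mul_T, mul_assoc, h.Tv, ← mul_assoc]
    module
  | succ m ih =>
    have h := H.pair hm
    have ih := ih (by omega)
    have h1 := (H.centralizes_t hm).cas_mul_right (z := z) (t m)
    have h2 := (H.centralizes_S hm).cas_mul_left (z := z) (t m * t (m + 1))
    have h3 := (H.commute_v_t hm (l := m) (by omega) (by omega) (by omega))
    rw [hcCas_succ_apply, H.braid_S_last hm, mul_assoc (hcS z t v (m + 1)), h2, h1]
    rw [smul_add, ← mul_smul_comm, ← smul_mul_assoc, ih, sub_mul, mul_sub, one_mul,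
      ← mul_assoc]
    have h4 : hcS z t v (m + 1) * t (m + 1) = _ := h.S_mul_T
    rw [h4, mul_assoc (v (m + 1)), h.Tv, ← mul_assoc, hcJ.eq_2 z t v (m + 1)]
    module

end IsHeckeClifford
end Casimir

section Nakayama
variable {R : Type*} [Ring R] [Algebra ℂ R] {z : ℂ} {N : ℕ} {t v : ℕ → R}
namespace IsHeckeClifford
variable (H : IsHeckeClifford z N t v)
include H

/-- The twisted trace property of the relative Casimir operator. -/
theorem cas_v_mul_J {m : ℕ} (hm : m < N) {g : R} (hg : HCCentralizes t v m g) :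
    hcCas z t v m (v m * hcJ z t v m * g * v m) = hcCas z t v m g := by
  induction m generalizing g with
  | zero =>
    have h := H.vsq 0 hm
    rw [hcCas_zero_apply, hcCas_zero_apply, hcJ, mul_one, add_comm]
    congr 1
    calc v 0 * (v 0 * g * v 0) * v 0 = (v 0 * v 0) * g * (v 0 * v 0) := by simp only [mul_assoc]
      _ = g := by rw [h, one_mul, mul_one]
  | succ m ih =>
    have ih := @ih (by omega)
    have hp := H.pair hm
    set c := v (m + 1) * (hcJ z t v (m + 1) * g) * v (m + 1) with hc
    have hcc : HCCentralizes t v (m + 1) c :=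
      H.centralizes_conj ((H.centralizes_J hm).mul hg) le_rfl hm
    have hvv := H.vsq _ hm
    have hww := H.vsq m (by omega)
    have hTv : t m * (v (m + 1) * hcJ z t v (m + 1)) = v m * hcJ z t v m * t m := by
      rw [hcJ, ← mul_assoc (v (m + 1)), ← mul_assoc (v (m + 1)), hcS, hp.w_mul_S,
        ← mul_assoc, ← mul_assoc, ← mul_assoc, hp.T_inv, one_mul]
    have hvS : v (m + 1) * hcS z t v m = hcS z t v m * v m - z • v m + z • v (m + 1) := by
      rw [hcS, hp.w_mul_S, add_mul, sub_mul, smul_mul_assoc, smul_mul_assoc, one_mul, mul_assoc,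
        hp.wv, mul_neg, ← mul_assoc, hww, one_mul]
      module
    have e : t m * c * hcS z t v m = v m * hcJ z t v m * (t m * g * hcS z t v m) * v m
        - z • (v m * hcJ z t v m * t m * v m * g) + z • (t m * c) := by
      have e1 : t m * c = v m * hcJ z t v m * t m * g * v (m + 1) := by
        rw [hc, ← hTv]; simp only [mul_assoc]
      have e2 : v m * g = g * v m := hg.comm_v m (by omega)
      rw [e1, mul_assoc _ (v (m + 1)), hvS, mul_assoc _ (v m) g, e2, mul_add, mul_sub,
        mul_smul_comm, mul_smul_comm]
      simp only [mul_assoc]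
    have hJc : hcJ z t v (m + 1) * c = v (m + 1) * g * v (m + 1) := by
      have h1 := H.v_mul_Jinv hm
      rw [hc, ← mul_assoc, ← mul_assoc, ← h1, mul_assoc (v (m + 1)), ← mul_assoc _ _ g,
        H.Jinv_mul_J hm, one_mul]
    have hvcv : v (m + 1) * c * v (m + 1) = hcJ z t v (m + 1) * g := by
      calc _ = (v (m + 1) * v (m + 1)) * (hcJ z t v (m + 1) * g) * (v (m + 1) * v (m + 1)) := by
            rw [hc]; simp only [mul_assoc]
        _ = _ := by rw [hvv, one_mul, mul_one]
    rw [mul_assoc (v (m + 1)), ← hc, hcCas_succ_apply, hcCas_succ_apply, e, map_add, map_sub,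
      map_smul, map_smul, ih (H.centralizes_TgS hm hg), hg.cas_mul_right, ih (H.centralizes_t hm),
      hcc.cas_mul_right, ← smul_mul_assoc, ← smul_mul_assoc, H.smul_cas_t hm, sub_mul, sub_mul,
      hJc, hvcv]
    simp only [one_mul]
    abel

end IsHeckeClifford
end Nakayama

section Abstract
variable {R : Type*} [Ring R] [Algebra ℂ R] {z u : ℂ}

theorem resolvent_step_normal_form {J Ji b F O β : R} (hJ : J * Ji = 1) (hJ' : Ji * J = 1) (hbJ : Commute b J)
    (hbJi : Commute b Ji) (hFJ : Commute J F) (hFJi : Commute Ji F) (hbF : Commute b F)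
    (hbO : Commute b O) (hOJ : J * O = O * Ji) (hOJi : Ji * O = O * J)
    (hβ : β = ((1 - z ^ 2 • F) * (J - 1) + z ^ 2 • (O * (J + 1))) * b) :
    b + b + (F + β * (1 - Ji) + b * ((J * β + z ^ 2 • (J * O)) - (β * Ji + z ^ 2 • F)
      - Ji * (β * Ji + z ^ 2 • O) + (β - z ^ 2 • F))) =
    F + (1 - z ^ 2 • F) * (b * (J + Ji) + b ^ 2 * ((J + Ji) ^ 2 - 4)) := by
  have r (p q : R) (h : p * q = q * p) (y : R) : p * (q * y) = q * (p * y) := by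
    rw [← mul_assoc, h, mul_assoc]
  have c1 (y) : J * (Ji * y) = y := by rw [← mul_assoc, hJ, one_mul]
  have c2 (y) : Ji * (J * y) = y := by rw [← mul_assoc, hJ', one_mul]
  have c3 (y) : J * (O * y) = O * (Ji * y) := by rw [← mul_assoc, hOJ, mul_assoc]
  have c4 (y) : Ji * (O * y) = O * (J * y) := by rw [← mul_assoc, hOJi, mul_assoc]
  have h4 : (4 : R) = (4 : ℂ) • (1 : R) := by
    rw [Algebra.smul_def, mul_one, map_ofNat]
  subst hβ
  rw [h4]
  simp only [pow_two, mul_add, add_mul, mul_sub, sub_mul, mul_assoc, smul_mul_assoc, mul_smul_comm,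
    one_mul, mul_one, smul_add, smul_sub, hJ, hJ', c1, c2, c3, c4, hOJ, hOJi, hbJ.eq, hbJi.eq,
    hFJ.eq, hFJi.eq, hbF.eq, hbO.eq, r _ _ hbJ.eq, r _ _ hbJi.eq, r _ _ hFJ.eq, r _ _ hFJi.eq,
    r _ _ hbF.eq, r _ _ hbO.eq]
  module

theorem resolvent_step {T S e J Ji J' Ji' a b : R} (D : R →ₗ[ℂ] R)
    (hTT : T * T = 1 + z • T) (hee : e * e = -1) (hTe : T * e = z • e + z • 1 - e * T)
    (hS : S = T + z • e) (hSi : (S - z • 1) * S = 1) (hTi : T * (T - z • 1) = 1)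
    (hJ' : J' = S * J * T) (hJi' : Ji' = (T - z • 1) * Ji * (S - z • 1))
    (heJ' : e * J' = Ji' * e) (heJi' : e * Ji' = J' * e)
    (h1 : J' * Ji' = 1) (h2 : Ji' * J' = 1)
    (ha : a * (u • 1 - (J + Ji)) = 1) (haJ' : Commute a J') (haJi' : Commute a Ji')
    (hb : (u • 1 - (J' + Ji')) * b = 1) (hbJ' : Commute b J')
    (hbJi' : Commute b Ji') (hbJi : Commute b Ji) (hbe : Commute b e) (hba : Commute b a)
    (hDJ' : ∀ g, D (g * J') = D g * J') (hDJi' : ∀ g, D (g * Ji') = D g * Ji')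
    (hDb : ∀ g, D (g * b) = D g * b) (hJ'D : ∀ g, D (J' * g) = J' * D g)
    (hJi'D : ∀ g, D (Ji' * g) = Ji' * D g) (hbD : ∀ g, D (b * g) = b * D g)
    (n1 : D (a * Ji) = D a) (n2 : D (a * (Ji * e)) = -D (a * e))
    (n3 : D (a * (e * T)) = D (a * (Ji * T))) (n4 : D (a * (Ji * (e * T))) = D (a * T))
    (hDT : z • D T = J' - 1) :
    b + b + D (T * b * S) = D a + (1 - z ^ 2 • D a) *
      (b * (J' + Ji') + b ^ 2 * ((J' + Ji') ^ 2 - 4)) := by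
  have hFJ : Commute J' (D a) := by rw [Commute, SemiconjBy, ← hJ'D, ← hDJ', haJ'.eq]
  have hFJi : Commute Ji' (D a) := by rw [Commute, SemiconjBy, ← hJi'D, ← hDJi', haJi'.eq]
  have hbF : Commute b (D a) := by rw [Commute, SemiconjBy, ← hbD, ← hDb, hba.eq]
  have hbO : Commute b (D (a * e)) := by
    rw [Commute, SemiconjBy, ← hbD, ← hDb, (hba.mul_right hbe).eq]
  have hOJ : J' * D (a * e) = D (a * e) * Ji' := by
    rw [← hJ'D, ← hDJi', mul_assoc a, heJi', ← mul_assoc, ← mul_assoc, haJ'.eq]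
  have hOJi : Ji' * D (a * e) = D (a * e) * J' := by
    rw [← hJi'D, ← hDJ', mul_assoc a, heJ', ← mul_assoc, ← mul_assoc, haJi'.eq]
  have r1 : T * J' = J * T + z • J' - z • (e * J') := by
    have : (S - z • 1) * J' = J * T := by rw [hJ', ← mul_assoc, ← mul_assoc, hSi, one_mul]
    rw [← this, hS]
    simp only [sub_mul, add_mul, smul_mul_assoc, one_mul]
    module
  have r2 : T * Ji' = Ji * T + z • (Ji * e) - z • Ji := by
    have : T * Ji' = Ji * (S - z • 1) := by rw [hJi', ← mul_assoc, ← mul_assoc, hTi, one_mul]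
    rw [this, hS]
    simp only [mul_sub, mul_add, mul_smul_comm, mul_one]
  have hα : z • D (a * T) = ((1 - z ^ 2 • D a) * (J' - 1) + z ^ 2 • (D (a * e) * (J' + 1))) * b := by
    have q1 : D (a * T) * J' = D (a * (J * T)) + z • (D a * J') - z • (D (a * e) * J') := by
      rw [← hDJ', mul_assoc, r1, mul_sub, mul_add, mul_smul_comm, mul_smul_comm, map_sub, map_add,
        map_smul, map_smul, hDJ', ← mul_assoc a e, hDJ']
    have q2 : D (a * T) * Ji' = D (a * (Ji * T)) - z • D (a * e) - z • D a := by
      rw [← hDJi', mul_assoc, r2, mul_sub, mul_add, mul_smul_comm, mul_smul_comm, map_sub, map_add,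
        map_smul, map_smul, n1, n2]
      module
    have q3 : D (a * (J * T)) + D (a * (Ji * T)) = u • D (a * T) - D T := by
      have : a * (J * T) + a * (Ji * T) = u • (a * T) - a * (u • 1 - (J + Ji)) * T := by
        simp only [mul_sub, mul_add, sub_mul, add_mul, mul_smul_comm, smul_mul_assoc, mul_one,
          mul_assoc]
        module
      rw [← map_add, this, ha, one_mul, map_sub, map_smul]
    have q4 : z • D (a * T) * (u • 1 - (J' + Ji')) =
        (1 - z ^ 2 • D a) * (J' - 1) + z ^ 2 • (D (a * e) * (J' + 1)) := by
      have q3' : D (a * (Ji * T)) = u • D (a * T) - D T - D (a * (J * T)) := by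
        rw [← q3]; abel
      rw [q3'] at q2
      rw [smul_mul_assoc, mul_sub, mul_add, q1, q2, mul_smul_comm, mul_one]
      simp only [sub_mul, mul_sub, mul_add, one_mul, mul_one, smul_mul_assoc]
      linear_combination (norm := module) hDT
    rw [← q4, mul_assoc, hb, mul_one]
  have q5 : D (a * (Ji * T)) = D (a * T) * Ji' + z • D (a * e) + z • D a := by
    rw [← hDJi', mul_assoc, r2, mul_sub, mul_add, mul_smul_comm, mul_smul_comm, map_sub, map_add,
      map_smul, map_smul, n1, n2]
    module
  have hTb : T * b = a * T + z • (b * (a * (J' - Ji - Ji' * e + Ji * e))) := by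
    have w1 : T * (J' + Ji') = (J + Ji) * T + z • (J' - Ji - Ji' * e + Ji * e) := by
      rw [mul_add, r1, r2, heJ']
      simp only [add_mul]
      module
    have w2 : Commute b (J' - Ji - Ji' * e + Ji * e) :=
      ((hbJ'.sub_right hbJi).sub_right (hbJi'.mul_right hbe)).add_right (hbJi.mul_right hbe)
    have w3 : (u • 1 - (J + Ji)) * T = T * (u • 1 - (J' + Ji')) +
        z • (J' - Ji - Ji' * e + Ji * e) := by
      rw [mul_sub, w1, sub_mul]
      simp only [smul_mul_assoc, mul_smul_comm, one_mul, mul_one]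
      abel
    calc T * b = a * ((u • 1 - (J + Ji)) * T) * b := by rw [← mul_assoc, ha, one_mul]
      _ = a * T * ((u • 1 - (J' + Ji')) * b) +
          z • (a * ((J' - Ji - Ji' * e + Ji * e) * b)) := by
        rw [w3]
        simp only [mul_add, add_mul, mul_assoc, smul_mul_assoc, mul_smul_comm]
      _ = _ := by rw [hb, mul_one, ← w2.eq, ← mul_assoc a b, ← hba.eq, mul_assoc b a]
  have heS : e * S = e * T - z • 1 := by
    rw [hS, mul_add, mul_smul_comm, hee, smul_neg, ← sub_eq_add_neg]
  have hTS : T * S = 1 + z • T + z ^ 2 • e + z ^ 2 • 1 - z • (e * T) := by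
    rw [hS, mul_add, mul_smul_comm, hTe, hTT]; module
  have p1 : D (a * (T * S)) = D a + (z • D (a * T)) * (1 - Ji') := by
    rw [hTS]
    simp only [mul_add, mul_sub, mul_smul_comm, mul_one, map_add, map_sub, map_smul, n3, q5,
      smul_mul_assoc]
    module
  have p2 : z • D (a * ((J' - Ji - Ji' * e + Ji * e) * S)) =
      (J' * (z • D (a * T)) + z ^ 2 • (J' * D (a * e))) - (z • D (a * T) * Ji' + z ^ 2 • D a)
      - Ji' * (z • D (a * T) * Ji' + z ^ 2 • D (a * e)) + (z • D (a * T) - z ^ 2 • D a) := by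
    have l1 (y) : a * (J' * y) = J' * (a * y) := by rw [← mul_assoc, haJ'.eq, mul_assoc]
    have l2 (y) : a * (Ji' * y) = Ji' * (a * y) := by rw [← mul_assoc, haJi'.eq, mul_assoc]
    simp only [add_mul, sub_mul, mul_assoc, heS]
    rw [hS]
    simp only [mul_add, mul_sub, mul_smul_comm, mul_one, map_add, map_sub, map_smul, n1, n2, n3, n4,
      l1, l2, haJi'.eq, hJ'D, hJi'D, q5, smul_mul_assoc]
    module
  have key := resolvent_step_normal_form h1 h2 hbJ' hbJi' hFJ hFJi hbF hbO hOJ hOJi hα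
  rw [← key, ← p2, ← p1, hTb]
  congr 1
  rw [add_mul, map_add, mul_assoc, mul_smul_comm, smul_mul_assoc, map_smul, mul_assoc b,
    mul_assoc a, hbD]

end Abstract

section Recursion
variable {R : Type*} [Ring R] [Algebra ℂ R] {z : ℂ} {N : ℕ} {t v : ℕ → R}

namespace HCCentralizes
theorem inv_sub {m : ℕ} {c a : R} {u : ℂ} (hc : HCCentralizes t v m c) (h : (u • 1 - c) * a = 1)
    (h' : a * (u • 1 - c) = 1) : HCCentralizes t v m a :=
  ((HCCentralizes.one.smul u).sub hc).of_inv h h'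
end HCCentralizes

theorem Commute.of_smul_one_sub_inv {y c a : R} {u : ℂ} (hc : Commute y c) (h : (u • 1 - c) * a = 1)
    (h' : a * (u • 1 - c) = 1) : Commute y a :=
  Commute.units_inv_right (u := ⟨_, _, h, h'⟩)
    (((Commute.one_right y).smul_right u).sub_right hc)

namespace IsHeckeClifford
variable (H : IsHeckeClifford z N t v)
include H

theorem commute_v_Jinv_of_lt {k j : ℕ} (hkj : k < j) (hj : j < N) :
    Commute (v j) (hcJinv z t v k) :=
  Commute.units_inv_right (u := ⟨_, _, H.J_mul_Jinv (by omega), H.Jinv_mul_J (by omega)⟩)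
    (H.commute_v_J_of_lt hkj hj)

theorem cas_resolvent_succ {m : ℕ} (hm : m + 1 < N) {u : ℂ} {a b : R}
    (ha : a * (u • 1 - hcX z t v m) = 1) (ha' : (u • 1 - hcX z t v m) * a = 1)
    (hb : b * (u • 1 - hcX z t v (m + 1)) = 1) (hb' : (u • 1 - hcX z t v (m + 1)) * b = 1) :
    hcCas z t v (m + 1) b = hcCas z t v m a + (1 - z ^ 2 • hcCas z t v m a) *
      (b * hcX z t v (m + 1) + b ^ 2 * (hcX z t v (m + 1) ^ 2 - 4)) := by
  have hp := H.pair hm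
  have hm' : m < N := by omega
  have hvv := H.vsq _ hm
  have hww := H.vsq m (by omega)
  have hac : HCCentralizes t v m a := (H.centralizes_X hm').inv_sub ha' ha
  have hbc : HCCentralizes t v (m + 1) b := (H.centralizes_X hm).inv_sub hb' hb
  have ca {y : R} (hy : Commute y (hcX z t v m)) : Commute y a := hy.of_smul_one_sub_inv ha' ha
  have cb {y : R} (hy : Commute y (hcX z t v (m + 1))) : Commute y b :=
    hy.of_smul_one_sub_inv hb' hb
  have hav : Commute (v m) a := ca (H.commute_v_X hm')
  have haw : Commute (v (m + 1)) a :=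
    ca ((H.commute_v_J_of_lt (by omega) hm).add_right (H.commute_v_Jinv_of_lt (by omega) hm))
  have hbv : Commute (v m) b := hbc.comm_v m (by omega)
  have hbw : Commute (v (m + 1)) b := cb (H.commute_v_X hm)
  have haJ : Commute (hcJ z t v m) a := ca (H.commute_J_X hm' hm')
  have haJi : Commute (hcJinv z t v m) a := ca (H.commute_Jinv_X hm' hm')
  have hbJi : Commute (hcJinv z t v m) b := cb (H.commute_Jinv_X hm' hm)
  have cJ' := H.centralizes_J hm
  have cJi' := H.centralizes_Jinv hm
  have cJi := H.centralizes_Jinv hm'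
  have cT := H.centralizes_t hm
  have ce : HCCentralizes t v m (v m * v (m + 1)) :=
    ⟨fun j hj => H.commute_v_vv (by omega) (by omega) hm (by omega) (by omega),
      fun i hi => ((H.commute_v_t (i := i) (by omega) hm' (by omega) (by omega)).symm).mul_right
        ((H.commute_v_t (i := i) (by omega) hm (by omega) (by omega)).symm)⟩
  have nak {g : R} (hg : HCCentralizes t v m g) :
      hcCas z t v m (v m * (a * (g * v m))) = hcCas z t v m (a * (hcJinv z t v m * g)) := by
    rw [← H.cas_v_mul_J hm' (hac.mul (cJi.mul hg))]
    congr 1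
    have hq (y) : hcJ z t v m * (a * (hcJinv z t v m * y)) = a * y := by
      rw [← mul_assoc, haJ.eq, mul_assoc, ← mul_assoc (hcJ z t v m), H.J_mul_Jinv hm', one_mul]
    simp only [mul_assoc, hq]
  have hva (y) : v m * (a * y) = a * (v m * y) := by rw [← mul_assoc, hav.eq, mul_assoc]
  rw [hcCas_succ_apply, mul_assoc (v (m + 1)), ← hbw.eq, ← mul_assoc, hvv, one_mul]
  refine resolvent_step (hcCas z t v m) (e := v m * v (m + 1)) (J := hcJ z t v m)
    (Ji := hcJinv z t v m) hp.quad ?_ ?_ rfl hp.inv_S hp.T_inv rfl rfl ?_ ?_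
    (H.J_mul_Jinv hm) (H.Jinv_mul_J hm) ha (ca (H.commute_J_X hm hm')).symm
    (ca (H.commute_Jinv_X hm hm')).symm hb'
    (cb (H.commute_J_X hm hm)).symm (cb (H.commute_Jinv_X hm hm)).symm hbJi.symm
    (hbv.mul_left hbw).symm (ca ?_) (fun g => cJ'.cas_mul_right g) (fun g => cJi'.cas_mul_right g)
    (fun g => hbc.cas_mul_right g) (fun g => cJ'.cas_mul_left g) (fun g => cJi'.cas_mul_left g)
    (fun g => hbc.cas_mul_left g) ?_ ?_ ?_ ?_ (H.smul_cas_t hm)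
  · rw [mul_assoc, ← mul_assoc (v (m + 1)), hp.wv, neg_mul, mul_assoc, hvv, mul_one, mul_neg, hww]
  · rw [← mul_assoc, hp.Tv, mul_assoc, hp.Tw, mul_sub, mul_smul_comm, mul_sub, hvv, ← mul_assoc,
      hp.wv, neg_mul]
    module
  · rw [mul_assoc, H.v_mul_J hm, ← mul_assoc, (cJi'.comm_v m (by omega)).eq, mul_assoc]
  · rw [mul_assoc, H.v_mul_Jinv hm, ← mul_assoc, (cJ'.comm_v m (by omega)).eq, mul_assoc]
  · exact (cb ((H.commute_X_X hm' hm))).symm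
  · have := nak HCCentralizes.one
    rw [one_mul, hva, hww, mul_one, mul_one] at this
    exact this.symm
  · rw [← nak ce, hva, ← map_neg, mul_assoc, hp.wv, mul_neg, mul_neg, ← mul_assoc (v m), hww,
      one_mul, mul_neg]
  · rw [← nak cT, hva, hp.Tv, ← mul_assoc (v m)]
  · rw [← nak (ce.mul cT), hva]
    congr 2
    rw [mul_assoc, hp.Tv, ← mul_assoc, ← mul_assoc (v m) (v m), hww, one_mul, ← mul_assoc, hvv,
      one_mul]

end IsHeckeClifford
end Recursion

section Scalars

theorem infinite_range_mul_sq_pow {q : ℂ} (hq0 : q ≠ 0) (hq : ∀ k : ℕ, 0 < k → q ^ k ≠ 1)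
    {w : ℂ} (hw : w ≠ 0) : (Set.range fun k : ℕ => w * (q ^ 2) ^ k).Infinite := by
  refine Set.infinite_range_of_injective ?_
  have key : ∀ j k : ℕ, j < k → w * (q ^ 2) ^ j ≠ w * (q ^ 2) ^ k := by
    intro j k hjk h
    have h1 := mul_left_cancel₀ hw h
    obtain ⟨d, rfl⟩ := Nat.exists_eq_add_of_lt hjk
    rw [add_assoc, pow_add] at h1
    have h2 : (q ^ 2) ^ (d + 1) = 1 :=
      (mul_eq_left₀ (pow_ne_zero j (pow_ne_zero 2 hq0))).mp h1.symm
    rw [← pow_mul] at h2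
    exact hq _ (by omega) h2
  intro j k h
  rcases lt_trichotomy j k with hlt | rfl | hlt
  · exact (key j k hlt h).elim
  · rfl
  · exact (key k j hlt h.symm).elim

theorem not_forall_prod_eq {q : ℂ} (hq0 : q ≠ 0) (hq : ∀ k : ℕ, 0 < k → q ^ k ≠ 1) (m : ℕ)
    (χ : ℕ → ℂ) (hχ : ∀ u : ℂ, ∏ i ∈ Finset.range (m + 1), (u - χ i) ^ 2 =
      ∏ i ∈ Finset.range (m + 1), ((u - χ i) ^ 2 - (q - q⁻¹) ^ 2 * (u * χ i - 4))) : False := by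
  have hq2 : q ^ 2 + 1 ≠ 0 := fun h => hq 4 (by norm_num) (by linear_combination (q ^ 2 - 1) * h)
  have hc : 2 * q / (q ^ 2 + 1) ≠ 0 := div_ne_zero (mul_ne_zero two_ne_zero hq0) hq2
  set c := 2 * q / (q ^ 2 + 1) with hcdef
  have step : ∀ w : ℂ, w ≠ 0 → (∃ i ∈ Finset.range (m + 1), c * (w + w⁻¹) = χ i) →
      ∃ i ∈ Finset.range (m + 1), c * (w * q ^ 2 + (w * q ^ 2)⁻¹) = χ i := by
    rintro w hw ⟨i, hi, h⟩
    have h0 := hχ (c * (w * q ^ 2 + (w * q ^ 2)⁻¹))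
    rw [Finset.prod_eq_zero (i := i) (f := fun i => _ - _) hi, Finset.prod_eq_zero_iff] at h0
    · obtain ⟨j, hj, h1⟩ := h0
      exact ⟨j, hj, sub_eq_zero.mp (pow_eq_zero_iff two_ne_zero |>.mp h1)⟩
    · rw [← h, hcdef]
      field_simp
      ring
  obtain ⟨w, hw, h0⟩ : ∃ w : ℂ, w ≠ 0 ∧ c * (w + w⁻¹) = χ 0 := by
    obtain ⟨w, hw⟩ := IsAlgClosed.exists_root
      (Polynomial.X ^ 2 - Polynomial.C (χ 0 / c) * Polynomial.X + 1 : Polynomial ℂ) (by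
        have : (Polynomial.X ^ 2 - Polynomial.C (χ 0 / c) * Polynomial.X + 1 : Polynomial ℂ).degree
          = 2 := by compute_degree!
        rw [this]; norm_num)
    simp only [Polynomial.IsRoot.def, Polynomial.eval_add, Polynomial.eval_sub, Polynomial.eval_pow,
      Polynomial.eval_X, Polynomial.eval_mul, Polynomial.eval_C, Polynomial.eval_one] at hw
    have hw0 : w ≠ 0 := by
      rintro rfl
      norm_num at hw
    refine ⟨w, hw0, ?_⟩
    field_simp at hw ⊢
    linear_combination hw
  have all : ∀ k : ℕ, ∃ i ∈ Finset.range (m + 1),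
      c * (w * (q ^ 2) ^ k + (w * (q ^ 2) ^ k)⁻¹) = χ i := by
    intro k
    induction k with
    | zero => exact ⟨0, by simp, by simpa using h0⟩
    | succ k ih =>
      have := step _ (mul_ne_zero hw (pow_ne_zero k (pow_ne_zero 2 hq0))) ih
      rwa [mul_assoc, ← pow_succ] at this
  have hfin : (⋃ i ∈ Finset.range (m + 1),
      ((Polynomial.X ^ 2 - Polynomial.C (χ i / c) * Polynomial.X + 1 : Polynomial ℂ).rootSet ℂ)).Finite :=
    Set.Finite.biUnion (Finset.finite_toSet _) fun i _ => Polynomial.rootSet_finite _ _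
  refine infinite_range_mul_sq_pow hq0 hq hw (hfin.subset ?_)
  rintro _ ⟨k, rfl⟩
  obtain ⟨i, hi, h⟩ := all k
  have hy : w * (q ^ 2) ^ k ≠ 0 := mul_ne_zero hw (pow_ne_zero k (pow_ne_zero 2 hq0))
  simp only [Set.mem_iUnion]
  refine ⟨i, hi, ?_⟩
  rw [Polynomial.mem_rootSet]
  constructor
  · intro h'
    have := congrArg (Polynomial.eval 0) h'
    simp at this
  · simp only [map_add, map_sub, map_mul, map_pow, Polynomial.aeval_X, Polynomial.aeval_C, map_one]
    rw [← h]
    simp only [Algebra.algebraMap_self, RingHom.id_apply]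
    generalize w * (q ^ 2) ^ k = y at hy ⊢
    field_simp
    ring

end Scalars

theorem Module.End.exists_joint_eigenvector {V : Type*} [AddCommGroup V] [Module ℂ V]
    [FiniteDimensional ℂ V] [Nontrivial V] (x : ℕ → Module.End ℂ V) (m : ℕ)
    (hx : ∀ i < m, ∀ j < m, Commute (x i) (x j)) :
    ∃ (χ : ℕ → ℂ) (w : V), w ≠ 0 ∧ ∀ i < m, x i w = χ i • w := by
  induction m with
  | zero =>
    obtain ⟨w, hw⟩ := exists_ne (0 : V)
    exact ⟨0, w, hw, fun i hi => by omega⟩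
  | succ m ih =>
    obtain ⟨χ, w, hw, h⟩ := ih fun i hi j hj => hx i (by omega) j (by omega)
    let W : Submodule ℂ V := ⨅ i : Fin m, LinearMap.ker (x i - χ i • 1)
    have hW : ∀ y, y ∈ W ↔ ∀ i < m, x i y = χ i • y := by
      intro y
      simp only [W, Submodule.mem_iInf, LinearMap.mem_ker, LinearMap.sub_apply,
        LinearMap.smul_apply, Module.End.one_apply, sub_eq_zero]
      exact ⟨fun h i hi => h ⟨i, hi⟩, fun h i => h i i.2⟩
    have hmaps : ∀ y ∈ W, x m y ∈ W := by
      intro y hy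
      rw [hW] at hy ⊢
      intro i hi
      have hc := LinearMap.congr_fun (hx i (by omega) m (by omega)).eq y
      rw [Module.End.mul_apply, Module.End.mul_apply, hy i hi, map_smul] at hc
      exact hc
    have : Nontrivial W := ⟨⟨⟨w, (hW w).2 h⟩, 0, fun h0 => hw (congrArg Subtype.val h0)⟩⟩
    obtain ⟨μ, hμ⟩ := Module.End.exists_eigenvalue ((x m).restrict hmaps)
    obtain ⟨y, hy⟩ := hμ.exists_hasEigenvector
    refine ⟨Function.update χ m μ, y, fun h0 => hy.2 (Subtype.ext h0), fun i hi => ?_⟩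
    rcases Nat.lt_succ_iff_lt_or_eq.mp hi with hlt | rfl
    · rw [Function.update_of_ne (by omega)]
      exact (hW y).1 y.2 i hlt
    · rw [Function.update_self]
      exact congrArg Subtype.val hy.apply_eq_smul

theorem spectrum.finite_of_finiteDimensional {A : Type*} [Ring A] [Algebra ℂ A] [FiniteDimensional ℂ A] (a : A) :
    (spectrum ℂ a).Finite := by
  have hint : IsIntegral ℂ a := Algebra.IsIntegral.isIntegral a
  refine ((minpoly ℂ a).rootSet_finite ℂ).subset fun μ hμ => ?_
  rw [Polynomial.mem_rootSet]
  refine ⟨minpoly.ne_zero hint, ?_⟩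
  have h := spectrum.subset_polynomial_aeval a (minpoly ℂ a) ⟨μ, hμ, rfl⟩
  rw [minpoly.aeval] at h
  by_contra hne
  refine h ?_
  rw [spectrum.mem_resolventSet_iff, sub_zero]
  refine (IsUnit.mk0 _ ?_).map _
  simpa [Polynomial.aeval_def, Polynomial.eval₂_eq_eval_map] using hne

theorem prod_eq_of_forall_notMem {z : ℂ} (m : ℕ) (χ : ℕ → ℂ) {B : Set ℂ} (hB : B.Finite)
    (h : ∀ u ∉ B, (∀ i ≤ m, u ≠ χ i) ∧ ∏ i ∈ Finset.range (m + 1),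
      (1 - z ^ 2 * ((u - χ i)⁻¹ * χ i + (u - χ i)⁻¹ ^ 2 * (χ i ^ 2 - 4))) = 1) (u : ℂ) :
    ∏ i ∈ Finset.range (m + 1), (u - χ i) ^ 2 =
      ∏ i ∈ Finset.range (m + 1), ((u - χ i) ^ 2 - z ^ 2 * (u * χ i - 4)) := by
  open Polynomial in
  have hp : ∏ i ∈ Finset.range (m + 1), (X - C (χ i)) ^ 2 =
      ∏ i ∈ Finset.range (m + 1), ((X - C (χ i)) ^ 2 - C (z ^ 2) * (X * C (χ i) - C 4)) := by
    refine Polynomial.eq_of_infinite_eval_eq _ _ (hB.infinite_compl.mono fun u hu => ?_)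
    obtain ⟨h1, h2⟩ := h u hu
    simp only [Set.mem_ofPred_eq, eval_prod, eval_pow, eval_sub, eval_X, eval_C, eval_mul]
    rw [← mul_one (∏ i ∈ _, (u - χ i) ^ 2), ← h2, ← Finset.prod_mul_distrib]
    refine Finset.prod_congr rfl fun i hi => ?_
    have : u - χ i ≠ 0 := sub_ne_zero.mpr (h1 i (by simpa [Nat.lt_succ_iff] using hi))
    field_simp
    ring
  have := congrArg (Polynomial.eval u) hp
  simpa only [Polynomial.eval_prod, Polynomial.eval_pow, Polynomial.eval_sub, Polynomial.eval_X,
    Polynomial.eval_C, Polynomial.eval_mul] using this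

section Faithful
variable {A : Type*} [Ring A] [Algebra ℂ A] [FiniteDimensional ℂ A] {q : ℂ} {m : ℕ} {t v : ℕ → A}

theorem IsHeckeClifford.false_of_cas_smul_eq_zero (hq0 : q ≠ 0) (hq : ∀ k : ℕ, 0 < k → q ^ k ≠ 1)
    (H : IsHeckeClifford (q - q⁻¹) (m + 1) t v) {V : Type*} [AddCommGroup V] [Module A V]
    [Module ℂ V] [IsScalarTower ℂ A V] [FiniteDimensional ℂ V] [Nontrivial V]
    (hF : ∀ (u : ℂ) (a : A), a * (u • 1 - hcX (q - q⁻¹) t v m) = 1 →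
      (u • 1 - hcX (q - q⁻¹) t v m) * a = 1 → ∀ w : V, hcCas (q - q⁻¹) t v m a • w = 0) :
    False := by
  set z := q - q⁻¹
  obtain ⟨χ, w, hw, hχ⟩ := Module.End.exists_joint_eigenvector
    (fun i => Algebra.lsmul ℂ ℂ V (hcX z t v i)) (m + 1)
    (fun i hi j hj => (H.commute_X_X hi hj).map (Algebra.lsmul ℂ ℂ V))
  simp only [Algebra.lsmul_coe] at hχ
  refine not_forall_prod_eq hq0 hq m χ (prod_eq_of_forall_notMem m χ
    (B := ⋃ i ∈ Finset.range (m + 1), spectrum ℂ (hcX z t v i))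
    (Set.Finite.biUnion (Finset.finite_toSet _)
      fun i _ => spectrum.finite_of_finiteDimensional _) fun u hu => ?_)
  simp only [Set.mem_iUnion, not_exists, Finset.mem_range, Nat.lt_succ_iff] at hu
  have hunit : ∀ i, i ≤ m → ∃ b : A, b * (u • 1 - hcX z t v i) = 1 ∧
      (u • 1 - hcX z t v i) * b = 1 := by
    intro i hi
    obtain ⟨b, hb⟩ := not_not.mp (hu i hi)
    rw [Algebra.algebraMap_eq_smul_one] at hb
    exact ⟨↑b⁻¹, by rw [← hb, Units.inv_mul], by rw [← hb, Units.mul_inv]⟩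
  choose! b hb using hunit
  have hsub : ∀ i ≤ m, (u • (1 : A) - hcX z t v i) • w = (u - χ i) • w := by
    intro i hi
    rw [sub_smul, sub_smul, hχ i (by omega), smul_assoc, one_smul]
  have hne : ∀ i ≤ m, u ≠ χ i := by
    intro i hi h
    have h1 := hsub i hi
    rw [sub_eq_zero.mpr h, zero_smul] at h1
    apply hw
    rw [← one_smul A w, ← (hb i hi).1, mul_smul, h1, smul_zero]
  have hbw : ∀ i ≤ m, b i • w = (u - χ i)⁻¹ • w := by
    intro i hi
    have h1 : w = (u - χ i) • (b i • w) := by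
      conv_lhs => rw [← one_smul A w, ← (hb i hi).1, mul_smul, hsub i hi, smul_comm]
    conv_rhs => rw [h1]
    rw [inv_smul_smul₀ (sub_ne_zero.mpr (hne i hi))]
  refine ⟨hne, ?_⟩
  have key : ∀ k ≤ m, (1 - z ^ 2 • hcCas z t v k (b k)) • w = (∏ i ∈ Finset.range (k + 1),
      (1 - z ^ 2 * ((u - χ i)⁻¹ * χ i + (u - χ i)⁻¹ ^ 2 * (χ i ^ 2 - 4)))) • w := by
    intro k hk
    have h4 : (4 : A) • w = (4 : ℂ) • w := by
      rw [← map_ofNat (algebraMap ℂ A) 4, algebraMap_smul]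
    have hs (c : ℂ) (y : V) (a : A) : a • (c • y) = c • (a • y) := smul_comm _ _ _
    have hfac : ∀ k ≤ m, (b k * hcX z t v k + b k ^ 2 * (hcX z t v k ^ 2 - 4)) • w =
        ((u - χ k)⁻¹ * χ k + (u - χ k)⁻¹ ^ 2 * (χ k ^ 2 - 4)) • w := by
      intro k hk
      simp only [add_smul, sub_smul, mul_smul, pow_two, hχ k (by omega), hs, hbw k hk, h4, smul_sub]
      module
    induction k with
    | zero =>
      have h2 : χ 0 = 2 := by
        have h1 := hχ 0 (by omega)
        have : (2 : ℂ) • w = χ 0 • w := by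
          rw [← h1, hcX, hcJ, hcJinv, add_smul, one_smul, two_smul]
        exact (smul_left_injective ℂ hw this).symm
      have hv : Commute (v 0) (b 0) :=
        (H.commute_v_X (by omega)).of_smul_one_sub_inv (hb 0 hk).2 (hb 0 hk).1
      rw [hcCas_zero_apply, hv.eq, mul_assoc, H.vsq 0 (by omega), mul_one]
      simp only [zero_add, Finset.prod_range_one, h2, sub_smul, add_smul, smul_assoc, one_smul,
        hbw 0 hk]
      module
    | succ k ih =>
      have ih := ih (by omega)
      have h1 := H.cas_resolvent_succ (by omega) (hb k (by omega)).1 (hb k (by omega)).2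
        (hb (k + 1) hk).1 (hb (k + 1) hk).2
      have h2 : 1 - z ^ 2 • hcCas z t v (k + 1) (b (k + 1)) = (1 - z ^ 2 • hcCas z t v k (b k)) *
          (1 - z ^ 2 • (b (k + 1) * hcX z t v (k + 1) +
            b (k + 1) ^ 2 * (hcX z t v (k + 1) ^ 2 - 4))) := by
        rw [h1, mul_sub (1 - _ • _), mul_one, mul_smul_comm]
        module
      rw [h2, mul_smul, sub_smul 1 (_ • (_ + _)), one_smul, smul_assoc, hfac _ hk,
        Finset.prod_range_succ, mul_comm (∏ i ∈ Finset.range (k + 1), _), mul_smul, ← ih]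
      rw [← hs, sub_smul 1 (_ * _) w, one_smul, mul_smul]
  have h1 := key m le_rfl
  rw [sub_smul, one_smul, smul_assoc, hF u (b m) (hb m le_rfl).1 (hb m le_rfl).2, smul_zero,
    sub_zero] at h1
  exact smul_left_injective ℂ hw (by simpa using h1.symm)

theorem IsHeckeClifford.ideal_center_eq_top (hq0 : q ≠ 0) (hq : ∀ k : ℕ, 0 < k → q ^ k ≠ 1)
    (H : IsHeckeClifford (q - q⁻¹) (m + 1) t v) (I : Ideal (Subalgebra.center ℂ A))
    (hI : ∀ (u : ℂ) (a : A), a * (u • 1 - hcX (q - q⁻¹) t v m) = 1 →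
      (u • 1 - hcX (q - q⁻¹) t v m) * a = 1 → ∃ c ∈ I, (c : A) = hcCas (q - q⁻¹) t v m a) :
    I = ⊤ := by
  by_contra hne
  let J : Submodule A A :=
    { (I • (⊤ : Submodule (Subalgebra.center ℂ A) A)).toAddSubmonoid with
      smul_mem' := by
        intro a x hx
        change x ∈ I • (⊤ : Submodule (Subalgebra.center ℂ A) A) at hx
        change a • x ∈ I • (⊤ : Submodule (Subalgebra.center ℂ A) A)
        refine Submodule.smul_induction_on hx (fun r hr y _ => ?_) (fun x y hx hy => ?_)
        · have : a • r • y = r • (a * y) := by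
            rw [Subalgebra.smul_def, Subalgebra.smul_def, smul_eq_mul, smul_eq_mul, smul_eq_mul,
              ← mul_assoc, ← mul_assoc, Subalgebra.mem_center_iff.1 r.2 a]
          rw [this]
          exact Submodule.smul_mem_smul hr trivial
        · rw [smul_add]
          exact add_mem hx hy }
  have hJ : ∀ c ∈ I, ∀ y : A, (c : A) * y ∈ J := fun c hc y =>
    Submodule.smul_mem_smul (I := I) (N := ⊤) hc trivial
  have hJtop : J ≠ ⊤ := by
    intro htop
    have hfin : Module.Finite (Subalgebra.center ℂ A) A := Module.Finite.of_restrictScalars_finite ℂ _ _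
    obtain ⟨r, hr, hr'⟩ := Submodule.exists_sub_one_mem_and_smul_eq_zero_of_fg_of_le_smul I
      (⊤ : Submodule (Subalgebra.center ℂ A) A) hfin.1 (fun x _ => by
        have : x ∈ J := htop ▸ trivial
        exact this)
    have h0 : r = 0 := by
      have := hr' 1 trivial
      ext
      simpa [Subalgebra.smul_def] using this
    have h1 : -(r - 1) = 1 := by rw [h0]; ext; simp
    exact hne ((Ideal.eq_top_iff_one I).2 (h1 ▸ I.neg_mem hr))
  have : Nontrivial (A ⧸ J) := Submodule.Quotient.nontrivial_iff.mpr hJtop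
  have : FiniteDimensional ℂ (A ⧸ J) :=
    Module.Finite.of_surjective (J.mkQ.restrictScalars ℂ) J.mkQ_surjective
  refine H.false_of_cas_smul_eq_zero (V := A ⧸ J) hq0 hq fun u a h1 h2 w => ?_
  obtain ⟨c, hc, hcF⟩ := hI u a h1 h2
  obtain ⟨y, rfl⟩ := J.mkQ_surjective w
  rw [← map_smul, ← hcF, Submodule.mkQ_apply, Submodule.Quotient.mk_eq_zero]
  exact hJ c hc y

end Faithful

section FiniteDimension
variable {R : Type*} [Ring R] [Algebra ℂ R] {z : ℂ} {N : ℕ} {t v : ℕ → R}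

/-- The subalgebra generated by the generators supported on the first `m` strands. -/
def hcSub (t v : ℕ → R) (m : ℕ) : Subalgebra ℂ R :=
  Algebra.adjoin ℂ (v '' {j | j < m} ∪ t '' {i | i + 1 < m})

theorem v_mem_hcSub {m j : ℕ} (hj : j < m) : v j ∈ hcSub t v m :=
  Algebra.subset_adjoin (Or.inl ⟨j, hj, rfl⟩)

theorem t_mem_hcSub {m i : ℕ} (hi : i + 1 < m) : t i ∈ hcSub t v m :=
  Algebra.subset_adjoin (Or.inr ⟨i, hi, rfl⟩)

theorem hcSub_mono {k m : ℕ} (h : k ≤ m) : hcSub t v k ≤ hcSub t v m :=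
  Algebra.adjoin_mono (Set.union_subset_union
    (Set.image_mono fun _ hj => lt_of_lt_of_le hj h)
    (Set.image_mono fun _ hj => lt_of_lt_of_le hj h))

theorem hcSub_zero : hcSub t v 0 = ⊥ := by simp [hcSub]

theorem HCCentralizes.commute_of_mem {m : ℕ} {g b : R} (hg : HCCentralizes t v m g)
    (hb : b ∈ hcSub t v m) : Commute b g := by
  induction hb using Algebra.adjoin_induction with
  | mem x hx =>
    rcases hx with ⟨j, hj, rfl⟩ | ⟨i, hi, rfl⟩
    · exact hg.comm_v j hj
    · exact hg.comm_t i hi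
  | algebraMap r => exact Algebra.commutes r g
  | add x y _ _ hx hy => exact hx.add_left hy
  | mul x y _ _ hx hy => exact hx.mul_left hy

/-- The space `B + v B + B s B`. -/
def hcSpan (B : Subalgebra ℂ R) (v s : R) : Submodule ℂ R :=
  B.toSubmodule ⊔ (ℂ ∙ v) * B.toSubmodule ⊔ B.toSubmodule * (ℂ ∙ s) * B.toSubmodule

section hcSpan
variable {B : Subalgebra ℂ R} {w s b c x : R}

theorem mem_hcSpan (hb : b ∈ B) : b ∈ hcSpan B w s :=
  Submodule.mem_sup_left (Submodule.mem_sup_left hb)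

theorem mul_mem_hcSpan (hb : b ∈ B) : w * b ∈ hcSpan B w s :=
  Submodule.mem_sup_left (Submodule.mem_sup_right
    (Submodule.mul_mem_mul (Submodule.mem_span_singleton_self w) hb))

theorem mul_mul_mem_hcSpan (hb : b ∈ B) (hc : c ∈ B) : b * s * c ∈ hcSpan B w s :=
  Submodule.mem_sup_right (Submodule.mul_mem_mul
    (Submodule.mul_mem_mul hb (Submodule.mem_span_singleton_self s)) hc)

theorem hcSpan_le {P : Submodule ℂ R} (h₁ : ∀ b ∈ B, b ∈ P) (h₂ : ∀ b ∈ B, w * b ∈ P)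
    (h₃ : ∀ b ∈ B, ∀ c ∈ B, b * s * c ∈ P) : hcSpan B w s ≤ P := by
  refine sup_le (sup_le h₁ ?_) ?_
  · rw [Submodule.mul_le]
    intro y hy b hb
    obtain ⟨r, rfl⟩ := Submodule.mem_span_singleton.1 hy
    rw [smul_mul_assoc]
    exact P.smul_mem r (h₂ b hb)
  · rw [mul_assoc, Submodule.mul_le]
    intro b hb y hy
    refine Submodule.mul_induction_on hy (fun y hy c hc => ?_) fun y y' hy hy' => ?_
    · obtain ⟨r, rfl⟩ := Submodule.mem_span_singleton.1 hy
      rw [smul_mul_assoc, mul_smul_comm, ← mul_assoc]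
      exact P.smul_mem r (h₃ b hb c hc)
    · rw [mul_add]
      exact P.add_mem hy hy'

theorem hcSpan_fg (hB : B.toSubmodule.FG) : (hcSpan B w s).FG :=
  (hB.sup ((Submodule.fg_span_singleton w).mul hB)).sup
    ((hB.mul (Submodule.fg_span_singleton s)).mul hB)

theorem mul_mem_hcSpan_of_mem (hb : b ∈ B) (hx : x ∈ hcSpan B w s) (hw : ∀ b ∈ B, ∃ c ∈ B, b * w = w * c) : b * x ∈ hcSpan B w s := by
  refine hcSpan_le (P := (hcSpan B w s).comap (LinearMap.mulLeft ℂ b)) ?_ ?_ ?_ hx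
  · exact fun c hc => mem_hcSpan (mul_mem hb hc)
  · intro c hc
    obtain ⟨d, hd, h⟩ := hw b hb
    change b * (w * c) ∈ hcSpan B w s
    rw [← mul_assoc, h, mul_assoc]
    exact mul_mem_hcSpan (mul_mem hd hc)
  · intro c hc d hd
    change b * (c * s * d) ∈ hcSpan B w s
    rw [← mul_assoc, ← mul_assoc]
    exact mul_mul_mem_hcSpan (mul_mem hb hc) hd

theorem adjoin_le_hcSpan {S : Set R} (h : ∀ g ∈ S, ∀ x ∈ hcSpan B w s, g * x ∈ hcSpan B w s) :
    (Algebra.adjoin ℂ S).toSubmodule ≤ hcSpan B w s := by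
  have key : ∀ y ∈ Algebra.adjoin ℂ S, ∀ x ∈ hcSpan B w s, y * x ∈ hcSpan B w s := by
    intro y hy
    induction hy using Algebra.adjoin_induction with
    | mem g hg => exact h g hg
    | algebraMap r =>
      intro x hx
      rw [← Algebra.smul_def]
      exact Submodule.smul_mem _ r hx
    | add y y' _ _ ih ih' =>
      intro x hx
      rw [add_mul]
      exact add_mem (ih x hx) (ih' x hx)
    | mul y y' _ _ ih ih' =>
      intro x hx
      rw [mul_assoc]
      exact ih _ (ih' x hx)
  intro y hy
  simpa using key y hy 1 (mem_hcSpan (one_mem B))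

end hcSpan

namespace IsHeckeClifford
variable (H : IsHeckeClifford z N t v)
include H

theorem exists_v_mul {m : ℕ} (hm : m < N) {b : R} (hb : b ∈ hcSub t v m) :
    ∃ c ∈ hcSub t v m, v m * b = c * v m ∧ b * v m = v m * c := by
  induction hb using Algebra.adjoin_induction with
  | mem x hx =>
    rcases hx with ⟨j, hj, rfl⟩ | ⟨i, hi, rfl⟩
    · have hj : j < m := hj
      refine ⟨-v j, neg_mem (v_mem_hcSub hj), ?_, ?_⟩
      · rw [H.vanti m j hm (by omega) (by omega), neg_mul]
      · rw [H.vanti j m (by omega) hm (by omega), mul_neg]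
    · have hi : i + 1 < m := hi
      have := (H.commute_v_t (i := i) (l := m) (by omega) hm (by omega) (by omega)).eq
      exact ⟨t i, t_mem_hcSub hi, this, this.symm⟩
  | algebraMap r =>
    exact ⟨algebraMap ℂ R r, Subalgebra.algebraMap_mem _ r, (Algebra.commutes r _).symm,
      Algebra.commutes r _⟩
  | add x y _ _ ihx ihy =>
    obtain ⟨a, ha, h1, h2⟩ := ihx
    obtain ⟨b, hb, h3, h4⟩ := ihy
    exact ⟨a + b, add_mem ha hb, by rw [mul_add, add_mul, h1, h3], by rw [mul_add, add_mul, h2, h4]⟩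
  | mul x y _ _ ihx ihy =>
    obtain ⟨a, ha, h1, h2⟩ := ihx
    obtain ⟨b, hb, h3, h4⟩ := ihy
    exact ⟨a * b, mul_mem ha hb, by rw [← mul_assoc, h1, mul_assoc, h3, mul_assoc],
      by rw [mul_assoc, h4, ← mul_assoc, h2, mul_assoc]⟩

theorem v_mul_v_mul {j : ℕ} (hj : j < N) (x : R) : v j * (v j * x) = x := by
  rw [← mul_assoc, H.vsq j hj, one_mul]

theorem hcSub_one_le (h1 : 0 < N) : (hcSub t v 1).toSubmodule ≤ hcSpan (hcSub t v 0) (v 0) 0 := by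
  refine adjoin_le_hcSpan fun g hg x hx => ?_
  obtain rfl : g = v 0 := by
    rcases hg with ⟨j, hj, rfl⟩ | ⟨i, hi, rfl⟩
    · rw [Nat.lt_one_iff.1 hj]
    · exact absurd hi (by simp)
  refine hcSpan_le (P := (hcSpan _ (v 0) 0).comap (LinearMap.mulLeft ℂ (v 0))) ?_ ?_ ?_ hx
  · exact fun c hc => mul_mem_hcSpan hc
  · intro c hc
    change v 0 * (v 0 * c) ∈ hcSpan (hcSub t v 0) (v 0) 0
    rw [H.v_mul_v_mul h1]
    exact mem_hcSpan hc
  · intro c hc d hd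
    simp

theorem hcSub_add_two_le {m : ℕ} (hm : m + 1 < N) {s : R}
    (hs : s = 0 ∨ (0 < m ∧ s = t (m - 1)))
    (ih : (hcSub t v (m + 1)).toSubmodule ≤ hcSpan (hcSub t v m) (v m) s) :
    (hcSub t v (m + 2)).toSubmodule ≤ hcSpan (hcSub t v (m + 1)) (v (m + 1)) (t m) := by
  set B := hcSub t v (m + 1) with hB
  set W := hcSpan B (v (m + 1)) (t m) with hW
  have hBW : ∀ b ∈ B, ∀ x ∈ W, b * x ∈ W := by
    refine fun b hb x hx => mul_mem_hcSpan_of_mem hb hx fun b hb => ?_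
    obtain ⟨c, hc, -, h⟩ := H.exists_v_mul hm hb
    exact ⟨c, hc, h⟩
  have htB : ∀ b ∈ B, t m * b ∈ W := fun b hb => by
    simpa using mul_mul_mem_hcSpan (w := v (m + 1)) (s := t m) (one_mem B) hb
  have hvm : v m ∈ B := v_mem_hcSub (by omega)
  have hvt : v (m + 1) * t m = t m * v m := (H.tv₁ m hm).symm
  have hvW : ∀ x ∈ W, v (m + 1) * x ∈ W := by
    intro x hx
    refine hcSpan_le (P := W.comap (LinearMap.mulLeft ℂ (v (m + 1)))) ?_ ?_ ?_ hx
    · exact fun c hc => mul_mem_hcSpan hc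
    · intro c hc
      change v (m + 1) * (v (m + 1) * c) ∈ W
      rw [H.v_mul_v_mul hm]
      exact mem_hcSpan hc
    · intro c hc d hd
      change v (m + 1) * (c * t m * d) ∈ W
      obtain ⟨c', hc', h, -⟩ := H.exists_v_mul hm hc
      rw [← mul_assoc, ← mul_assoc, h, mul_assoc c', hvt, ← mul_assoc, mul_assoc]
      exact mul_mul_mem_hcSpan hc' (mul_mem hvm hd)
  have httB : ∀ b ∈ B, t m * (t m * b) ∈ W := by
    intro b hb
    rw [← mul_assoc, H.quad m hm, add_mul, one_mul, smul_mul_assoc]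
    exact add_mem (mem_hcSpan hb) (W.smul_mem _ (htB b hb))
  have htW : ∀ x ∈ W, t m * x ∈ W := by
    intro x hx
    refine hcSpan_le (P := W.comap (LinearMap.mulLeft ℂ (t m))) htB ?_ ?_ hx
    · intro c hc
      change t m * (v (m + 1) * c) ∈ W
      rw [← mul_assoc, H.tv₂ m hm, sub_mul, smul_mul_assoc, sub_mul, mul_assoc]
      exact sub_mem (hBW _ hvm _ (htB c hc)) (W.smul_mem _
        (sub_mem (mem_hcSpan (mul_mem hvm hc)) (mul_mem_hcSpan hc)))
    · intro c hc d hd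
      change t m * (c * t m * d) ∈ W
      have hle : hcSub t v m ≤ B := hcSub_mono (by omega)
      have hcomm : ∀ b ∈ hcSub t v m, b * t m = t m * b := fun b hb =>
        ((H.centralizes_t hm).commute_of_mem hb).eq
      refine hcSpan_le (P := W.comap (LinearMap.mulLeft ℂ (t m) ∘ₗ LinearMap.mulRight ℂ (t m * d)))
        ?_ ?_ ?_ (ih hc) |> fun h => by simpa [mul_assoc] using h
      · intro b hb
        change t m * (b * (t m * d)) ∈ W
        rw [← mul_assoc b, hcomm b hb, mul_assoc]
        exact httB _ (mul_mem (hle hb) hd)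
      · intro b hb
        change t m * (v m * b * (t m * d)) ∈ W
        have : t m * (v m * b * (t m * d)) = v (m + 1) * (t m * (t m * (b * d))) := by
          rw [← mul_assoc (v (m + 1)), hvt, mul_assoc (v m), ← mul_assoc b, hcomm b hb]
          simp only [mul_assoc]
        rw [this]
        exact hvW _ (httB _ (mul_mem (hle hb) hd))
      · intro b hb b' hb'
        change t m * (b * s * b' * (t m * d)) ∈ W
        rcases hs with rfl | ⟨h0, rfl⟩
        · simp
        · obtain ⟨k, rfl⟩ : ∃ k, m = k + 1 := ⟨m - 1, by omega⟩
          rw [Nat.add_sub_cancel]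
          have : t (k + 1) * (b * t k * b' * (t (k + 1) * d)) =
              (b * t k) * t (k + 1) * (t k * (b' * d)) := by
            calc _ = (t (k + 1) * b) * (t k * ((b' * t (k + 1)) * d)) := by simp only [mul_assoc]
              _ = (b * t (k + 1)) * (t k * ((t (k + 1) * b') * d)) := by
                rw [hcomm b hb, hcomm b' hb']
              _ = b * (t (k + 1) * t k * t (k + 1)) * (b' * d) := by simp only [mul_assoc]
              _ = _ := by rw [← H.braid k hm]; simp only [mul_assoc]
          have htk : t k ∈ B := t_mem_hcSub (by omega)
          rw [this]
          exact mul_mul_mem_hcSpan (mul_mem (hle hb) htk) (mul_mem htk (mul_mem (hle hb') hd))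
  refine adjoin_le_hcSpan fun g hg x hx => ?_
  rcases hg with ⟨j, hj, rfl⟩ | ⟨i, hi, rfl⟩
  · rcases Nat.lt_succ_iff_lt_or_eq.1 hj with hj | rfl
    · exact hBW _ (v_mem_hcSub hj) x hx
    · exact hvW x hx
  · rcases Nat.lt_succ_iff_lt_or_eq.1 (Nat.lt_of_succ_lt_succ hi) with hi | rfl
    · exact hBW _ (t_mem_hcSub (by omega)) x hx
    · exact htW x hx

theorem hcSub_succ_le {m : ℕ} (hm : m < N) :
    ∃ s : R, (s = 0 ∨ (0 < m ∧ s = t (m - 1))) ∧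
      (hcSub t v (m + 1)).toSubmodule ≤ hcSpan (hcSub t v m) (v m) s := by
  induction m with
  | zero => exact ⟨0, Or.inl rfl, H.hcSub_one_le hm⟩
  | succ m ih =>
    obtain ⟨s, hs, h⟩ := ih (by omega)
    exact ⟨t m, Or.inr ⟨by omega, rfl⟩, H.hcSub_add_two_le hm hs h⟩

theorem hcSub_fg {m : ℕ} (hm : m ≤ N) : (hcSub t v m).toSubmodule.FG := by
  induction m with
  | zero =>
    rw [hcSub_zero, Algebra.toSubmodule_bot]
    exact ⟨{1}, by simp [Submodule.one_eq_span]⟩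
  | succ m ih =>
    obtain ⟨s, -, h⟩ := H.hcSub_succ_le hm
    have := Module.Finite.iff_fg.2 (hcSpan_fg (w := v m) (s := s) (ih (by omega)))
    exact Module.Finite.iff_fg.1 (Submodule.finiteDimensional_of_le h)

end IsHeckeClifford
end FiniteDimension

theorem isSemisimpleModule_of_forall_exists_proj {R M : Type*} [Ring R] [AddCommGroup M]
    [Module R M] (h : ∀ L : Submodule R M, ∃ g : M →ₗ[R] M, (∀ x, g x ∈ L) ∧ ∀ x ∈ L, g x = x) :
    IsSemisimpleModule R M := by
  refine { toComplementedLattice := ⟨fun L => ?_⟩ }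
  obtain ⟨g, hg, hg'⟩ := h L
  exact ⟨_, LinearMap.isCompl_of_proj (f := g.codRestrict L hg) fun x => Subtype.ext (hg' x x.2)⟩

theorem IsSemisimpleModule.exists_proj {R M : Type*} [Ring R] [AddCommGroup M]
    [Module R M] [IsSemisimpleModule R M] (L : Submodule R M) :
    ∃ g : M →ₗ[R] M, (∀ x, g x ∈ L) ∧ ∀ x ∈ L, g x = x := by
  obtain ⟨K, hK⟩ := exists_isCompl L
  refine ⟨L.subtype ∘ₗ L.projectionOnto K hK, fun x => Subtype.property _, fun x hx => ?_⟩
  exact congrArg Subtype.val (Submodule.projectionOnto_apply_left hK ⟨x, hx⟩)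

section Semisimple
universe u

section
variable {R S : Type*} [Ring R] [Algebra ℂ R] [Ring S] [Algebra ℂ S] {z : ℂ} {N m : ℕ}
  {t v : ℕ → R}

theorem IsHeckeClifford.map (H : IsHeckeClifford z N t v) (f : R →ₐ[ℂ] S) :
    IsHeckeClifford z N (f ∘ t) (f ∘ v) where
  braid i hi := by simpa using congrArg f (H.braid i hi)
  tcomm i j hij hj := by simpa using congrArg f (H.tcomm i j hij hj)
  quad i hi := by simpa using congrArg f (H.quad i hi)
  vsq j hj := by simpa using congrArg f (H.vsq j hj)
  vanti j k hj hk hjk := by simpa using congrArg f (H.vanti j k hj hk hjk)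
  tv₁ i hi := by simpa using congrArg f (H.tv₁ i hi)
  tv₂ i hi := by simpa using congrArg f (H.tv₂ i hi)
  tvcomm i l hi hl h₁ h₂ := by simpa using congrArg f (H.tvcomm i l hi hl h₁ h₂)

theorem IsHeckeClifford.of_map {f : R →ₐ[ℂ] S} (hf : Function.Injective f) {t' v' : ℕ → S}
    (H : IsHeckeClifford z N t' v') (hm : m ≤ N) (ht : ∀ i, i + 1 < m → f (t i) = t' i)
    (hv : ∀ j < m, f (v j) = v' j) : IsHeckeClifford z m t v where
  braid i hi := hf (by
    simpa [ht i (by omega), ht (i + 1) hi] using H.braid i (by omega))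
  tcomm i j hij hj := hf (by
    simpa [ht i (by omega), ht j hj] using H.tcomm i j hij (by omega))
  quad i hi := hf (by simpa [ht i hi] using H.quad i (by omega))
  vsq j hj := hf (by simpa [hv j hj] using H.vsq j (by omega))
  vanti j k hj hk hjk := hf (by
    simpa [hv j hj, hv k hk] using H.vanti j k (by omega) (by omega) hjk)
  tv₁ i hi := hf (by
    simpa [ht i hi, hv i (by omega), hv (i + 1) hi] using H.tv₁ i (by omega))
  tv₂ i hi := hf (by
    simpa [ht i hi, hv i (by omega), hv (i + 1) hi] using H.tv₂ i (by omega))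
  tvcomm i l hi hl h₁ h₂ := hf (by
    simpa [ht i hi, hv l hl] using H.tvcomm i l (by omega) (by omega) h₁ h₂)

theorem HCCentralizes.map {g : R} (hg : HCCentralizes t v m g) (f : R →ₐ[ℂ] S) :
    HCCentralizes (f ∘ t) (f ∘ v) m (f g) :=
  ⟨fun j hj => (hg.comm_v j hj).map f, fun i hi => (hg.comm_t i hi).map f⟩

theorem HCCentralizes.commute_map {f : R →ₐ[ℂ] S} {g : S}
    (hg : HCCentralizes (f ∘ t) (f ∘ v) m g) {b : R} (hb : b ∈ hcSub t v m) :
    Commute (f b) g := by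
  refine hg.commute_of_mem ?_
  rw [hcSub, Set.image_comp, Set.image_comp, ← Set.image_union, ← AlgHom.map_adjoin]
  exact ⟨b, hb, rfl⟩

theorem hcS_map (f : R →ₐ[ℂ] S) (k : ℕ) : hcS z (f ∘ t) (f ∘ v) k = f (hcS z t v k) := by
  simp [hcS]

theorem IsHeckeClifford.exists_hcSub (H : IsHeckeClifford z N t v) (hm : m ≤ N) :
    ∃ t' v' : ℕ → hcSub t v m, IsHeckeClifford z m t' v' ∧ hcSub t' v' m = ⊤ := by
  classical
  let t' : ℕ → hcSub t v m := fun i => if h : i + 1 < m then ⟨t i, t_mem_hcSub h⟩ else 0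
  let v' : ℕ → hcSub t v m := fun j => if h : j < m then ⟨v j, v_mem_hcSub h⟩ else 0
  have ht : ∀ i, i + 1 < m → (hcSub t v m).val (t' i) = t i := fun i hi => by simp [t', hi]
  have hv : ∀ j < m, (hcSub t v m).val (v' j) = v j := fun j hj => by simp [v', hj]
  refine ⟨t', v', H.of_map Subtype.val_injective hm ht hv, ?_⟩
  refine top_le_iff.1 (Algebra.adjoin_adjoin_coe_preimage.ge.trans (Algebra.adjoin_mono ?_))
  rintro x (⟨j, hj, h⟩ | ⟨i, hi, h⟩)
  · exact Or.inl ⟨j, hj, Subtype.ext ((hv j hj).trans h)⟩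
  · exact Or.inr ⟨i, hi, Subtype.ext ((ht i hi).trans h)⟩

theorem hcCas_lmul_apply (L : Submodule R R) (k : ℕ) {G : Module.End ℂ R} {b : R}
    (h₁ : ∀ x, G x ∈ L) (h₂ : ∀ x ∈ L, G x = b * x) :
    (∀ x, hcCas z (Algebra.lmul ℂ R ∘ t) (Algebra.lmul ℂ R ∘ v) k G x ∈ L) ∧
      ∀ x ∈ L, hcCas z (Algebra.lmul ℂ R ∘ t) (Algebra.lmul ℂ R ∘ v) k G x =
        hcCas z t v k b * x := by
  have hmul : ∀ a, ∀ x ∈ L, a * x ∈ L := fun a x hx => L.smul_mem a hx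
  induction k generalizing G b with
  | zero =>
    rw [hcCas_zero_apply, hcCas_zero_apply]
    refine ⟨fun x => add_mem (h₁ x) (hmul _ _ (h₁ _)), fun x hx => ?_⟩
    change G x + v 0 * G (v 0 * x) = _
    rw [h₂ x hx, h₂ _ (hmul _ _ hx)]
    simp only [add_mul, mul_assoc]
  | succ k ih =>
    rw [hcCas_succ_apply, hcCas_succ_apply, hcS_map]
    obtain ⟨h₃, h₄⟩ := ih (G := Algebra.lmul ℂ R (t k) * G * Algebra.lmul ℂ R (hcS z t v k))
      (b := t k * b * hcS z t v k) (fun x => hmul _ _ (h₁ _)) fun x hx => by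
        change t k * G (hcS z t v k * x) = _
        rw [h₂ _ (hmul _ _ hx)]
        simp only [mul_assoc]
    refine ⟨fun x => add_mem (add_mem (h₁ x) (hmul _ _ (h₁ _))) (h₃ x), fun x hx => ?_⟩
    have h₅ := h₄ x hx
    have h₆ : (G + (Algebra.lmul ℂ R ∘ v) (k + 1) * G * (Algebra.lmul ℂ R ∘ v) (k + 1)) x =
        G x + v (k + 1) * G (v (k + 1) * x) := rfl
    rw [add_mul, ← h₅, LinearMap.add_apply, h₆, h₂ x hx, h₂ _ (hmul _ _ hx), add_mul]
    simp only [mul_assoc]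
    rfl

end

/-- The central elements acting on the left ideal `L` as the restriction of an endomorphism with
values in `L`. -/
def projIdeal {A : Type*} [Ring A] [Algebra ℂ A] (L : Submodule A A) :
    Ideal (Subalgebra.center ℂ A) where
  carrier := {c | ∃ g : A →ₗ[A] A, (∀ x, g x ∈ L) ∧ ∀ x ∈ L, g x = c * x}
  zero_mem' := ⟨0, fun _ => L.zero_mem, fun x _ => by simp⟩
  add_mem' := by
    rintro c d ⟨g, hg, hg'⟩ ⟨h, hh, hh'⟩
    exact ⟨g + h, fun x => add_mem (hg x) (hh x), fun x hx => by
      simp [hg' x hx, hh' x hx, add_mul]⟩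
  smul_mem' := by
    rintro c d ⟨g, hg, hg'⟩
    refine ⟨{ toFun := fun x => c * g x, map_add' := fun x y => ?_, map_smul' := fun a x => ?_ },
      fun x => L.smul_mem (c : A) (hg x), fun x hx => ?_⟩
    · rw [map_add, mul_add]
    · rw [map_smul, smul_eq_mul, smul_eq_mul, RingHom.id_apply, ← mul_assoc, ← mul_assoc,
        Subalgebra.mem_center_iff.1 c.2 a]
    · change (c : A) * g x = _
      rw [hg' x hx, ← mul_assoc]
      rfl

theorem IsHeckeClifford.exists_proj {A : Type*} [Ring A] [Algebra ℂ A] {q : ℂ} {m : ℕ}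
    {t v : ℕ → A} (hq0 : q ≠ 0) (hq : ∀ k : ℕ, 0 < k → q ^ k ≠ 1)
    (H : IsHeckeClifford (q - q⁻¹) (m + 1) t v) (hgen : hcSub t v (m + 1) = ⊤)
    [IsSemisimpleRing (hcSub t v m)] (L : Submodule A A) :
    ∃ g : A →ₗ[A] A, (∀ x, g x ∈ L) ∧ ∀ x ∈ L, g x = x := by
  have hfin : FiniteDimensional ℂ A := by
    have := H.hcSub_fg le_rfl
    rw [hgen, Algebra.top_toSubmodule] at this
    exact ⟨this⟩
  obtain ⟨p, hp, hp'⟩ := IsSemisimpleModule.exists_proj (L.restrictScalars (hcSub t v m))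
  let P : Module.End ℂ A :=
    { p with
      map_smul' := fun c x => by
        simp }
  have hP : HCCentralizes (Algebra.lmul ℂ A ∘ t) (Algebra.lmul ℂ A ∘ v) m P := by
    refine ⟨fun j hj => ?_, fun i hi => ?_⟩
    · ext x
      exact (p.map_smul ⟨v j, v_mem_hcSub hj⟩ x).symm
    · ext x
      exact (p.map_smul ⟨t i, t_mem_hcSub hi⟩ x).symm
  have htop : projIdeal L = ⊤ := by
    refine H.ideal_center_eq_top hq0 hq _ fun u a ha ha' => ?_
    have hac : HCCentralizes t v m a := (H.centralizes_X (by omega)).inv_sub ha' ha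
    have hF : hcCas (q - q⁻¹) t v m a ∈ Subalgebra.center ℂ A := by
      rw [Subalgebra.mem_center_iff]
      intro b
      exact ((H.centralizes_cas (by omega) hac).commute_of_mem (hgen ▸ Algebra.mem_top)).eq
    refine ⟨⟨_, hF⟩, ?_, rfl⟩
    have hG := (H.map (Algebra.lmul ℂ A)).centralizes_cas (by omega)
      (hP.mul (hac.map (Algebra.lmul ℂ A)))
    obtain ⟨h₁, h₂⟩ := hcCas_lmul_apply (z := q - q⁻¹) (t := t) (v := v) L m
      (G := P * Algebra.lmul ℂ A a) (b := a) (fun x => hp _)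
      fun x hx => hp' _ (L.smul_mem a hx)
    refine ⟨{ hcCas (q - q⁻¹) (Algebra.lmul ℂ A ∘ t) (Algebra.lmul ℂ A ∘ v) m
        (P * Algebra.lmul ℂ A a) with map_smul' := fun b x => ?_ }, h₁, h₂⟩
    exact LinearMap.congr_fun (hG.commute_map (b := b) (hgen ▸ Algebra.mem_top)).eq.symm x
  obtain ⟨g, hg, hg'⟩ : (1 : Subalgebra.center ℂ A) ∈ projIdeal L := htop ▸ Submodule.mem_top
  exact ⟨g, hg, fun x hx => by simpa using hg' x hx⟩

theorem IsHeckeClifford.isSemisimpleRing {q : ℂ} (hq0 : q ≠ 0) (hq : ∀ k : ℕ, 0 < k → q ^ k ≠ 1)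
    {N : ℕ} {A : Type u} [Ring A] [Algebra ℂ A] {t v : ℕ → A}
    (H : IsHeckeClifford (q - q⁻¹) N t v) (hgen : hcSub t v N = ⊤) : IsSemisimpleRing A := by
  induction N generalizing A with
  | zero =>
    rw [hcSub_zero] at hgen
    exact RingHom.isSemisimpleRing_of_surjective (algebraMap ℂ A)
      (Algebra.surjective_algebraMap_iff.2 hgen.symm)
  | succ m ih =>
    obtain ⟨t', v', H', hgen'⟩ := H.exists_hcSub (m := m) (by omega)
    have := ih H' hgen'
    exact isSemisimpleModule_of_forall_exists_proj (H.exists_proj hq0 hq hgen)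

end Semisimple

section Even

theorem Subalgebra.isSemisimpleRing_of_parity {A : Type*} [Ring A] [Algebra ℂ A]
    [IsSemisimpleRing A] (E : Subalgebra ℂ A) (σ : A →ₐ[ℂ] A) (w : A) (hσ : ∀ e ∈ E, σ e = e)
    (hw : σ w = -w) (hE : ∀ a : A, ∃ x ∈ E, ∃ y ∈ E, a = x + w * y) : IsSemisimpleRing E := by
  refine isSemisimpleModule_of_forall_exists_proj fun L => ?_
  obtain ⟨π, hπ, hπ'⟩ := IsSemisimpleModule.exists_proj (Submodule.span A (E.val '' L))
  have hε := hπ 1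
  obtain ⟨x, hx, y, hy, hxy⟩ : ∃ x ∈ L, ∃ y ∈ L, π 1 = x + w * y := by
    generalize π 1 = a at hε
    induction hε using Submodule.closure_induction with
    | zero => exact ⟨0, L.zero_mem, 0, L.zero_mem, by simp⟩
    | add a b _ _ ha hb =>
      obtain ⟨x, hx, y, hy, rfl⟩ := ha
      obtain ⟨x', hx', y', hy', rfl⟩ := hb
      exact ⟨x + x', add_mem hx hx', y + y', add_mem hy hy', by push_cast; noncomm_ring⟩
    | smul_mem a b hb =>
      obtain ⟨l, hl, rfl⟩ := hb
      obtain ⟨x, hx, y, hy, rfl⟩ := hE a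
      exact ⟨⟨x, hx⟩ * l, L.smul_mem _ hl, ⟨y, hy⟩ * l, L.smul_mem _ hl, by
        simp [add_mul, mul_assoc]⟩
  refine ⟨LinearMap.toSpanSingleton E E x, fun r => L.smul_mem r hx, fun l hl => ?_⟩
  have h₁ : (l : A) = l * x + l * w * y := by
    have h := hπ' l (Submodule.subset_span ⟨l, hl, rfl⟩)
    rw [← mul_one (l : A), ← smul_eq_mul, map_smul, hxy, smul_eq_mul] at h
    conv_lhs => rw [← mul_one (l : A), ← smul_eq_mul, ← h]
    rw [mul_add, mul_assoc]
  have h₂ : (l : A) = l * x - l * w * y := by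
    have h := congrArg σ h₁
    rw [map_add, map_mul, map_mul, map_mul, hσ _ l.2, hσ _ x.2, hσ _ y.2, hw] at h
    rw [sub_eq_add_neg, ← neg_mul, ← mul_neg]
    exact h
  have h₃ : (2 : ℂ) • (l : A) = (2 : ℂ) • ((l : A) * x) := by
    have h : ∀ a b c : A, a = b + c → a = b - c → (2 : ℂ) • a = (2 : ℂ) • b := by
      intro a b c h h'
      rw [two_smul, two_smul]
      nth_rw 1 [h]
      rw [h']
      abel
    exact h _ _ _ h₁ h₂
  exact Subtype.ext (smul_right_injective A (two_ne_zero (α := ℂ)) h₃).symm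

variable {R : Type*} [Ring R] [Algebra ℂ R] {z : ℂ} {N : ℕ} {t v : ℕ → R}

theorem IsHeckeClifford.neg (H : IsHeckeClifford z N t v) : IsHeckeClifford z N t (-v) where
  braid := H.braid
  tcomm := H.tcomm
  quad := H.quad
  vsq j hj := by simpa using H.vsq j hj
  vanti j k hj hk hjk := by simpa using H.vanti j k hj hk hjk
  tv₁ i hi := by simpa using H.tv₁ i hi
  tv₂ i hi := by
    simp only [Pi.neg_apply, mul_neg, H.tv₂ i hi, neg_mul, smul_sub, smul_neg]
    abel
  tvcomm i l hi hl h₁ h₂ := by simpa using H.tvcomm i l hi hl h₁ h₂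

theorem IsHeckeClifford.exists_even_add (H : IsHeckeClifford z N t v) (hN : 0 < N)
    (hgen : hcSub t v N = ⊤) (E : Subalgebra ℂ R) (ht : ∀ i, i + 1 < N → t i ∈ E)
    (he : ∀ i, i + 1 < N → v i * v (i + 1) ∈ E) (a : R) :
    ∃ x ∈ E, ∃ y ∈ E, a = x + v 0 * y := by
  have hvv : ∀ j < N, v 0 * v j ∈ E := by
    intro j hj
    induction j with
    | zero => rw [H.vsq 0 hj]; exact one_mem E
    | succ j ih =>
      have : v 0 * v (j + 1) = v 0 * v j * (v j * v (j + 1)) := by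
        rw [mul_assoc, H.v_mul_v_mul (by omega)]
      rw [this]
      exact mul_mem (ih (by omega)) (he j hj)
  have key : ∀ b ∈ hcSub t v N, ∀ a, (∃ x ∈ E, ∃ y ∈ E, a = x + v 0 * y) →
      ∃ x ∈ E, ∃ y ∈ E, b * a = x + v 0 * y := by
    intro b hb
    induction hb using Algebra.adjoin_induction with
    | mem g hg =>
      rintro _ ⟨x, hx, y, hy, rfl⟩
      rcases hg with ⟨j, hj, rfl⟩ | ⟨i, hi, rfl⟩
      · have hj : j < N := hj
        rcases Nat.eq_zero_or_pos j with rfl | h0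
        · exact ⟨y, hy, x, hx, by rw [mul_add, H.v_mul_v_mul hj, add_comm]⟩
        · refine ⟨-(v 0 * v j * y), neg_mem (mul_mem (hvv j hj) hy), v 0 * v j * x,
            mul_mem (hvv j hj) hx, ?_⟩
          rw [mul_assoc, mul_assoc, H.v_mul_v_mul hN, mul_add, ← mul_assoc (v j),
            H.vanti j 0 hj hN (by omega), neg_mul, mul_assoc, add_comm]
      · have hi : i + 1 < N := hi
        rcases Nat.eq_zero_or_pos i with rfl | h0
        · refine ⟨t 0 * x, mul_mem (ht 0 hi) hx, v 0 * v 1 * (t 0 * y),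
            mul_mem (he 0 hi) (mul_mem (ht 0 hi) hy), ?_⟩
          rw [mul_assoc, H.v_mul_v_mul hN, mul_add, ← mul_assoc, ← mul_assoc, H.tv₁ 0 hi]
        · refine ⟨t i * x, mul_mem (ht i hi) hx, t i * y, mul_mem (ht i hi) hy, ?_⟩
          rw [mul_add, ← mul_assoc, ← mul_assoc, H.tvcomm i 0 hi hN (by omega) (by omega)]
    | algebraMap r =>
      rintro _ ⟨x, hx, y, hy, rfl⟩
      exact ⟨r • x, E.smul_mem hx r, r • y, E.smul_mem hy r, by
        rw [← Algebra.smul_def, smul_add, mul_smul_comm]⟩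
    | add b c _ _ hb hc =>
      intro a ha
      obtain ⟨x, hx, y, hy, h⟩ := hb a ha
      obtain ⟨x', hx', y', hy', h'⟩ := hc a ha
      exact ⟨x + x', add_mem hx hx', y + y', add_mem hy hy', by rw [add_mul, h, h']; noncomm_ring⟩
    | mul b c _ _ hb hc =>
      intro a ha
      rw [mul_assoc]
      exact hb _ (hc a ha)
  simpa using key a (hgen ▸ Algebra.mem_top) 1 ⟨1, one_mem E, 0, zero_mem E, by simp⟩

end Even

section Presentation
variable {q : ℂ} {n : ℕ}

/-- The generators `t i` of `HeckeClifford q n`, extended by zero. -/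
noncomputable def hcGenT (q : ℂ) (n i : ℕ) : HeckeClifford q n :=
  if h : i < n - 1 then HCt q n ⟨i, h⟩ else 0

/-- The generators `v j` of `HeckeClifford q n`, extended by zero. -/
noncomputable def hcGenV (q : ℂ) (n j : ℕ) : HeckeClifford q n :=
  if h : j < n then HCv q n ⟨j, h⟩ else 0

theorem hcGenT_of_lt {i : ℕ} (h : i < n - 1) : hcGenT q n i = HCt q n ⟨i, h⟩ := dif_pos h

theorem hcGenV_of_lt {j : ℕ} (h : j < n) : hcGenV q n j = HCv q n ⟨j, h⟩ := dif_pos h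

theorem isHeckeClifford_hcGen (q : ℂ) (n : ℕ) :
    IsHeckeClifford (q - q⁻¹) n (hcGenT q n) (hcGenV q n) where
  braid i hi := by
    rw [hcGenT_of_lt (i := i) (by omega), hcGenT_of_lt (i := i + 1) (by omega)]
    simpa [HCt, HCv] using RingQuot.mkAlgHom_rel ℂ
      (HCrel.braid (q := q) (n := n) ⟨i, by omega⟩ ⟨i + 1, by omega⟩ rfl)
  tcomm i j hij hj := by
    rw [hcGenT_of_lt (i := i) (by omega), hcGenT_of_lt (i := j) (by omega)]
    simpa [HCt, HCv] using RingQuot.mkAlgHom_rel ℂ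
      (HCrel.tcomm (q := q) (n := n) ⟨i, by omega⟩ ⟨j, by omega⟩ (Or.inl hij))
  quad i hi := by
    rw [hcGenT_of_lt (i := i) (by omega)]
    simpa [HCt, HCv] using RingQuot.mkAlgHom_rel ℂ (HCrel.quad (q := q) (n := n) ⟨i, by omega⟩)
  vsq j hj := by
    rw [hcGenV_of_lt hj]
    simpa [HCt, HCv] using RingQuot.mkAlgHom_rel ℂ (HCrel.vsq (q := q) (n := n) ⟨j, hj⟩)
  vanti j k hj hk hjk := by
    rw [hcGenV_of_lt hj, hcGenV_of_lt hk]
    simpa [HCt, HCv] using RingQuot.mkAlgHom_rel ℂ (HCrel.vanti (q := q) (n := n) ⟨j, hj⟩ ⟨k, hk⟩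
      (by simpa using hjk))
  tv₁ i hi := by
    rw [hcGenT_of_lt (i := i) (by omega), hcGenV_of_lt (j := i) (by omega), hcGenV_of_lt hi]
    simpa [HCt, HCv] using RingQuot.mkAlgHom_rel ℂ
      (HCrel.tv₁ (q := q) (n := n) ⟨i, by omega⟩ ⟨i, by omega⟩ ⟨i + 1, hi⟩ rfl rfl)
  tv₂ i hi := by
    rw [hcGenT_of_lt (i := i) (by omega), hcGenV_of_lt (j := i) (by omega), hcGenV_of_lt hi]
    simpa [HCt, HCv] using RingQuot.mkAlgHom_rel ℂ
      (HCrel.tv₂ (q := q) (n := n) ⟨i, by omega⟩ ⟨i, by omega⟩ ⟨i + 1, hi⟩ rfl rfl)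
  tvcomm i l hi hl h₁ h₂ := by
    rw [hcGenT_of_lt (i := i) (by omega), hcGenV_of_lt hl]
    simpa [HCt, HCv] using RingQuot.mkAlgHom_rel ℂ
      (HCrel.tvcomm (q := q) (n := n) ⟨i, by omega⟩ ⟨l, hl⟩ ⟨h₁, h₂⟩)

theorem hcSub_hcGen (q : ℂ) (n : ℕ) : hcSub (hcGenT q n) (hcGenV q n) n = ⊤ := by
  rw [← top_le_iff]
  rintro a -
  obtain ⟨b, rfl⟩ := RingQuot.mkAlgHom_surjective ℂ (HCrel q n) a
  induction b using FreeAlgebra.induction with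
  | grade0 r =>
    rw [AlgHom.commutes]
    exact Subalgebra.algebraMap_mem _ r
  | grade1 x =>
    rcases x with i | j
    · have := t_mem_hcSub (t := hcGenT q n) (v := hcGenV q n) (m := n) (i := i) (by omega)
      rwa [hcGenT_of_lt i.2] at this
    · have := v_mem_hcSub (t := hcGenT q n) (v := hcGenV q n) j.2
      rwa [hcGenV_of_lt j.2] at this
  | mul a b ha hb => rw [map_mul]; exact mul_mem ha hb
  | add a b ha hb => rw [map_add]; exact add_mem ha hb

theorem IsHeckeClifford.exists_algHom {S : Type*} [Ring S] [Algebra ℂ S] {t v : ℕ → S}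
    (H : IsHeckeClifford (q - q⁻¹) n t v) :
    ∃ f : HeckeClifford q n →ₐ[ℂ] S, (∀ i, f (HCt q n i) = t i) ∧ ∀ j, f (HCv q n j) = v j := by
  let F : FreeAlgebra ℂ (HCgen n) →ₐ[ℂ] S :=
    FreeAlgebra.lift ℂ (Sum.elim (fun i => t i) fun j => v j)
  have hFt : ∀ i, F (tF n i) = t i := fun i => by simp [F, tF]
  have hFv : ∀ j, F (vF n j) = v j := fun j => by simp [F, vF]
  have hF : ∀ ⦃x y⦄, HCrel q n x y → F x = F y := by
    intro x y h
    induction h with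
    | braid i j h => simpa [hFt, h] using H.braid i (by omega)
    | tcomm i j h =>
      simpa [hFt] using (H.commute_t_t h (by omega) (by omega)).eq
    | quad i => simpa [hFt] using H.quad i (by omega)
    | vsq j => simpa [hFv] using H.vsq j j.2
    | vanti j k h => simpa [hFv] using H.vanti j k j.2 k.2 (Fin.val_ne_of_ne h)
    | tv₁ i j j' hj hj' => simpa [hFt, hFv, hj, hj'] using H.tv₁ i (by omega)
    | tv₂ i j j' hj hj' => simpa [hFt, hFv, hj, hj'] using H.tv₂ i (by omega)
    | tvcomm i l h => simpa [hFt, hFv] using H.tvcomm i l (by omega) l.2 h.1 h.2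
  refine ⟨RingQuot.liftAlgHom ℂ ⟨F, hF⟩, fun i => ?_, fun j => ?_⟩
  · rw [HCt, RingQuot.liftAlgHom_mkAlgHom_apply, hFt]
  · rw [HCv, RingQuot.liftAlgHom_mkAlgHom_apply, hFv]

end Presentation

/-- if `q ≠ 0` is not a root of unity, then `G_n(q)` and its even
subalgebra `G_n[0]` are semisimple rings, for every `n ≥ 2`. -/
theorem heckeClifford_semisimple_of_not_rootOfUnity
    (q : ℂ) (hq0 : q ≠ 0) (hq : ∀ k : ℕ, 0 < k → q ^ k ≠ 1) (n : ℕ) (hn : 2 ≤ n) :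
    IsSemisimpleRing (HeckeClifford q n) ∧ IsSemisimpleRing (HCeven q n) := by
  have H := isHeckeClifford_hcGen q n
  have hA : IsSemisimpleRing (HeckeClifford q n) := H.isSemisimpleRing hq0 hq (hcSub_hcGen q n)
  refine ⟨hA, ?_⟩
  obtain ⟨σ, hσt, hσv⟩ := H.neg.exists_algHom
  have hσt' : ∀ i, σ (HCt q n i) = HCt q n i := fun i => by rw [hσt, hcGenT_of_lt i.2]
  have hσv' : ∀ j, σ (HCv q n j) = -HCv q n j := fun j => by
    rw [hσv, Pi.neg_apply, hcGenV_of_lt j.2]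
  refine (HCeven q n).isSemisimpleRing_of_parity σ (hcGenV q n 0) (fun e he => ?_) ?_
    (H.exists_even_add (by omega) (hcSub_hcGen q n) _ (fun i hi => ?_) fun i hi => ?_)
  · induction he using Algebra.adjoin_induction with
    | mem x hx =>
      rcases hx with ⟨i, rfl⟩ | ⟨i, rfl⟩
      · exact hσt' i
      · rw [HCe, map_mul, hσv', hσv']
        exact neg_mul_neg (HCv q n _) (HCv q n _)
    | algebraMap r => exact σ.commutes r
    | add x y _ _ hx hy => rw [map_add, hx, hy]
    | mul x y _ _ hx hy => rw [map_mul, hx, hy]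
  · rw [hcGenV_of_lt (by omega), hσv']
  · rw [hcGenT_of_lt (by omega)]
    exact Algebra.subset_adjoin (Or.inl ⟨_, rfl⟩)
  · rw [hcGenV_of_lt (j := i) (by omega), hcGenV_of_lt hi]
    exact Algebra.subset_adjoin (Or.inr ⟨⟨i, by omega⟩, rfl⟩)
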